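/- arXiv:1807.05772 — 3 statements merged into one kernel-verified Lean document; each statement's English description precedes it below -/
import Mathlib

section
/- Let F be a strictly balanced multigraph with n(F) vertices, m(F) ≥ 1 edges and density d = m(F)/n(F). Let c > 0 and let m = m(n) be a sequence of integers with m(n) → ∞ and m(n)/n^{2 − 1/d} → c. Then the number of (n, m(n))-multigraphs that contain no sub-multigraph isomorphic to F is asymptotically equal to e^{−λ} · n^{2 m(n)}, where λ = a_F · c^{m(F)} / (n(F)! · m(F)!); that is, the ratio of the number of F-free (n, m(n))-multigraphs to n^{2 m(n)} converges to e^{−λ}. -/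
open scoped Classical
open Filter Asymptotics

/-- `(S, L)` is a sub-multigraph of the multigraph `E : Fin m → Fin n × Fin n`:
both endpoints of every edge labeled in `L` lie in `S`. -/
def IsSubMG {n m : ℕ} (E : Fin m → Fin n × Fin n)
    (p : Finset (Fin n) × Finset (Fin m)) : Prop :=
  ∀ j ∈ p.2, (E j).1 ∈ p.1 ∧ (E j).2 ∈ p.1

/-- Isomorphism of multigraphs, disregarding edge labels and orientations. -/
def MGIso {k l k' l' : ℕ} (F : Fin l → Fin k × Fin k) (F' : Fin l' → Fin k' × Fin k') : Prop :=
  ∃ (σ : Fin k ≃ Fin k') (τ : Fin l ≃ Fin l'),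
    ∀ j, s((F' (τ j)).1, (F' (τ j)).2) = s(σ (F j).1, σ (F j).2)

/-- The sub-multigraph `p` of `E` is isomorphic to the multigraph `F`. -/
def SubMGIso {k l n m : ℕ} (F : Fin l → Fin k × Fin k)
    (E : Fin m → Fin n × Fin n) (p : Finset (Fin n) × Finset (Fin m)) : Prop :=
  ∃ (σ : Fin k ↪ Fin n) (τ : Fin l ↪ Fin m),
    (p.1 : Set (Fin n)) = Set.range σ ∧ (p.2 : Set (Fin m)) = Set.range τ ∧
    ∀ j, s((E (τ j)).1, (E (τ j)).2) = s(σ (F j).1, σ (F j).2)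

/-- The number `G[F]` of sub-multigraphs of `E` isomorphic to `F`. -/
noncomputable def countSubMG {k l n m : ℕ} (F : Fin l → Fin k × Fin k)
    (E : Fin m → Fin n × Fin n) : ℕ :=
  Set.ncard {p : Finset (Fin n) × Finset (Fin m) | IsSubMG E p ∧ SubMGIso F E p}

/-- `F` is strictly balanced: its density exceeds that of every nonempty proper
sub-multigraph. -/
def StrictlyBalancedMG {k l : ℕ} (F : Fin l → Fin k × Fin k) : Prop :=
  ∀ p : Finset (Fin k) × Finset (Fin l), IsSubMG F p → p.1.Nonempty →
    ¬(p.1 = Finset.univ ∧ p.2 = Finset.univ) →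
    (p.2.card : ℝ) / p.1.card < (l : ℝ) / k

/-- degree of a vertex in a multigraph (a loop counts twice) -/
def degMG {k l : ℕ} (E : Fin l → Fin k × Fin k) (v : Fin k) : ℕ :=
  (Finset.univ.filter fun ji : Fin l × Fin 2 =>
    (if ji.2 = 0 then (E ji.1).1 else (E ji.1).2) = v).card

/-- connectedness of a multigraph -/
def MGConnected {k l : ℕ} (E : Fin l → Fin k × Fin k) : Prop :=
  (SimpleGraph.fromRel fun v w => ∃ j, E j = (v, w)).Connected

/-- weight of a multigraph coming from vertex-degree weights `δ` -/
noncomputable def wMG {n m : ℕ} (δ : ℕ → ℝ) (E : Fin m → Fin n × Fin n) : ℝ :=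
  ∏ v : Fin n, δ (degMG E v)

/-- total weight of all `(n,m)`-multigraphs -/
noncomputable def MGw (n m : ℕ) (δ : ℕ → ℝ) : ℝ :=
  ∑ E : Fin m → Fin n × Fin n, wMG δ E

/-- the entire function `Δ(x) = Σ_d δ(d) x^d / d!` (finite support) -/
noncomputable def DeltaFun (δ : ℕ → ℝ) : ℝ → ℝ :=
  fun x => ∑ᶠ d : ℕ, δ d * x ^ d / d.factorial

open scoped BigOperators

/-- Functions of complementary sets of coordinates are independent under the uniform
distribution on `κ → α`. -/
lemma expect_mul_of_dependsOn_compl {κ α : Type*} [Fintype κ] [DecidableEq κ] [Fintype α]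
    [Nonempty α] (L : Finset κ) (f g : (κ → α) → ℝ)
    (hf : ∀ E E', (∀ j ∈ L, E j = E' j) → f E = f E')
    (hg : ∀ E E', (∀ j ∉ L, E j = E' j) → g E = g E') :
    𝔼 E, f E * g E = (𝔼 E, f E) * 𝔼 E, g E := by
  have hswap : ∑ x : (κ → α) × (κ → α), f x.1 * g x.2
      = ∑ x : (κ → α) × (κ → α), f x.1 * g x.1 := by
    have hinv : Function.Involutive
        (fun x : (κ → α) × (κ → α) => (L.piecewise x.1 x.2, L.piecewise x.2 x.1)) := by
      rintro ⟨E, E'⟩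
      ext j <;> by_cases hj : j ∈ L <;> simp [hj]
    refine Fintype.sum_equiv hinv.toPerm _ _ ?_
    rintro ⟨E, E'⟩
    congr 1
    · exact hf _ _ fun j hj => by simp [Function.Involutive.toPerm, hj]
    · exact hg _ _ fun j hj => by simp [Function.Involutive.toPerm, hj]
  rw [Fintype.sum_prod_type, Fintype.sum_prod_type, ← Finset.sum_mul_sum] at hswap
  simp only [Finset.sum_const, Finset.card_univ, nsmul_eq_mul, ← Finset.mul_sum] at hswap
  have hN : (Fintype.card (κ → α) : ℝ) ≠ 0 := by
    exact_mod_cast Fintype.card_ne_zero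
  simp only [Fintype.expect_eq_sum_div_card]
  field_simp
  rw [hswap, mul_comm]

lemma pow_sub_pow_add_mem_Icc {t : ℝ} (h0 : 0 ≤ t) (h1 : t ≤ 1) (a b : ℕ) :
    0 ≤ t ^ a - t ^ (a + b) ∧ t ^ a - t ^ (a + b) ≤ b := by
  have ha : 0 ≤ t ^ a := pow_nonneg h0 a
  have ha' : t ^ a ≤ 1 := pow_le_one₀ h0 h1
  have hb : 0 ≤ t ^ b := pow_nonneg h0 b
  have hb' : t ^ b ≤ 1 := pow_le_one₀ h0 h1
  rw [pow_add]
  refine ⟨by nlinarith, ?_⟩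
  rcases Nat.eq_zero_or_pos b with rfl | hpos
  · simp
  · have : (1 : ℝ) ≤ b := by exact_mod_cast hpos
    nlinarith [mul_nonneg ha hb]

/-- For `0`-`1` random variables `X i` on the uniform product space `κ → α`, where `X i` depends
only on the coordinates in `L i`, this bounds the change made by removing `X i` from the
generating function of the sum. -/
lemma abs_expect_mul_pow_sub_le {κ α ι : Type*} [Fintype κ] [DecidableEq κ] [Fintype α]
    [Nonempty α] [Fintype ι] (X : ι → (κ → α) → ℕ) (L : ι → Finset κ)
    (hX : ∀ i E, X i E ≤ 1)
    (hdep : ∀ i E E', (∀ j ∈ L i, E j = E' j) → X i E = X i E')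
    (hne : ∀ i E, X i E ≠ 0 → (L i).Nonempty) {t : ℝ} (h0 : 0 ≤ t) (h1 : t ≤ 1) (i : ι) :
    |(𝔼 E, (X i E : ℝ) * t ^ (∑ j, X j E - 1)) - (𝔼 E, (X i E : ℝ)) * 𝔼 E, t ^ (∑ j, X j E)|
      ≤ (∑ j with ¬ Disjoint (L i) (L j), (𝔼 E, (X i E : ℝ)) * 𝔼 E, (X j E : ℝ))
        + ∑ j with ¬ Disjoint (L i) (L j) ∧ j ≠ i, 𝔼 E, (X i E * X j E : ℝ) := by
  set V : (κ → α) → ℕ := fun E => ∑ j with Disjoint (L i) (L j), X j E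
  have hsplit : ∀ E, ∑ j, X j E = V E + ∑ j with ¬ Disjoint (L i) (L j), X j E := fun E =>
    (Finset.sum_filter_add_sum_filter_not _ _ _).symm
  have hself : ∀ E, X i E ≠ 0 → ∑ j with ¬ Disjoint (L i) (L j), X j E
      = X i E + ∑ j with ¬ Disjoint (L i) (L j) ∧ j ≠ i, X j E := by
    intro E hE
    have hi : i ∈ Finset.univ.filter fun j => ¬ Disjoint (L i) (L j) := by
      simpa [Finset.not_disjoint_iff, Finset.Nonempty] using hne i E hE
    rw [← Finset.add_sum_erase _ _ hi]
    congr 2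
    ext j
    simp [and_comm]
  have hind : 𝔼 E, (X i E : ℝ) * t ^ V E = (𝔼 E, (X i E : ℝ)) * 𝔼 E, t ^ V E := by
    refine expect_mul_of_dependsOn_compl (L i) _ _ (fun E E' h => by rw [hdep i E E' h]) ?_
    intro E E' h
    have : V E = V E' := by
      refine Finset.sum_congr rfl fun j hj => hdep j E E' fun x hx => h x ?_
      exact Finset.disjoint_right.1 (Finset.mem_filter.1 hj).2 hx
    rw [this]
  have hlocal : ∀ E, 0 ≤ (X i E : ℝ) * t ^ V E - (X i E : ℝ) * t ^ (∑ j, X j E - 1) ∧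
      (X i E : ℝ) * t ^ V E - (X i E : ℝ) * t ^ (∑ j, X j E - 1)
        ≤ ∑ j with ¬ Disjoint (L i) (L j) ∧ j ≠ i, (X i E * X j E : ℝ) := by
    intro E
    rcases Nat.eq_zero_or_pos (X i E) with hz | hpos
    · simp [hz]
    · have hone : X i E = 1 := le_antisymm (hX i E) hpos
      have hexp : ∑ j, X j E - 1
          = V E + ∑ j with ¬ Disjoint (L i) (L j) ∧ j ≠ i, X j E := by
        rw [hsplit E, hself E hpos.ne', hone]; omega
      rw [hexp]
      simpa [hone] using
        pow_sub_pow_add_mem_Icc h0 h1 (V E) (∑ j with ¬ Disjoint (L i) (L j) ∧ j ≠ i, X j E)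
  have hglobal : ∀ E, 0 ≤ t ^ V E - t ^ (∑ j, X j E) ∧
      t ^ V E - t ^ (∑ j, X j E) ≤ ∑ j with ¬ Disjoint (L i) (L j), (X j E : ℝ) := by
    intro E
    rw [hsplit E]
    simpa using pow_sub_pow_add_mem_Icc h0 h1 (V E) (∑ j with ¬ Disjoint (L i) (L j), X j E)
  have hμ : 0 ≤ 𝔼 E, (X i E : ℝ) := Finset.expect_nonneg fun E _ => Nat.cast_nonneg _
  have hl0 := Finset.expect_nonneg (s := Finset.univ) fun E _ => (hlocal E).1
  have hl1 := Finset.expect_le_expect (s := Finset.univ) fun E _ => (hlocal E).2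
  have hg0 := Finset.expect_nonneg (s := Finset.univ) fun E _ => (hglobal E).1
  have hg1 := Finset.expect_le_expect (s := Finset.univ) fun E _ => (hglobal E).2
  rw [Finset.expect_sub_distrib] at hl0 hl1 hg0 hg1
  rw [Finset.expect_sum_comm] at hl1 hg1
  rw [hind] at hl0 hl1
  rw [← Finset.mul_sum, abs_le]
  constructor <;> nlinarith [mul_le_mul_of_nonneg_left hg1 hμ, mul_nonneg hμ hg0,
    hg0.trans hg1, mul_nonneg hμ (hg0.trans hg1), hl0.trans hl1]

/-- Poisson approximation of the probability that no event occurs, for dissociated `0`-`1` random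
variables on a uniform product space. -/
lemma abs_expect_zero_pow_sub_exp_le {κ α ι : Type*} [Fintype κ] [DecidableEq κ] [Fintype α]
    [Nonempty α] [Fintype ι] (X : ι → (κ → α) → ℕ) (L : ι → Finset κ)
    (hX : ∀ i E, X i E ≤ 1)
    (hdep : ∀ i E E', (∀ j ∈ L i, E j = E' j) → X i E = X i E')
    (hne : ∀ i E, X i E ≠ 0 → (L i).Nonempty) :
    |(𝔼 E, (0 : ℝ) ^ (∑ j, X j E)) - Real.exp (-∑ i, 𝔼 E, (X i E : ℝ))|
      ≤ (∑ i, ∑ j with ¬ Disjoint (L i) (L j), (𝔼 E, (X i E : ℝ)) * 𝔼 E, (X j E : ℝ))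
        + ∑ i, ∑ j with ¬ Disjoint (L i) (L j) ∧ j ≠ i, 𝔼 E, (X i E * X j E : ℝ) := by
  set Λ : ℝ := ∑ i, 𝔼 E, (X i E : ℝ) with hΛ
  set φ : ℝ → ℝ := fun t => 𝔼 E, t ^ (∑ j, X j E) with hφ
  have hΛ0 : 0 ≤ Λ :=
    Finset.sum_nonneg fun i _ => Finset.expect_nonneg fun E _ => Nat.cast_nonneg _
  have hφ' : ∀ t, HasDerivAt φ (∑ i, 𝔼 E, (X i E : ℝ) * t ^ (∑ j, X j E - 1)) t := by
    intro t
    rw [← Finset.expect_sum_comm]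
    simp only [hφ, Fintype.expect_eq_sum_div_card, ← Finset.sum_mul]
    refine HasDerivAt.div_const (HasDerivAt.fun_sum fun E _ => ?_) _
    simpa using hasDerivAt_pow (∑ j, X j E) t
  have hg' : ∀ t, HasDerivAt (fun t => Real.exp (-(Λ * t)) * φ t)
      (Real.exp (-(Λ * t)) * ((∑ i, 𝔼 E, (X i E : ℝ) * t ^ (∑ j, X j E - 1)) - Λ * φ t)) t := by
    intro t
    have he : HasDerivAt (fun t => Real.exp (-(Λ * t))) (Real.exp (-(Λ * t)) * (-(Λ * 1))) t :=
      (((hasDerivAt_id t).const_mul Λ).neg).exp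
    exact (he.mul (hφ' t)).congr_deriv (by ring)
  set B : ℝ := (∑ i, ∑ j with ¬ Disjoint (L i) (L j), (𝔼 E, (X i E : ℝ)) * 𝔼 E, (X j E : ℝ))
        + ∑ i, ∑ j with ¬ Disjoint (L i) (L j) ∧ j ≠ i, 𝔼 E, (X i E * X j E : ℝ) with hB
  have hbound : ∀ t ∈ Set.Icc (0 : ℝ) 1, ‖Real.exp (-(Λ * t)) *
      ((∑ i, 𝔼 E, (X i E : ℝ) * t ^ (∑ j, X j E - 1)) - Λ * φ t)‖ ≤ B := by
    rintro t ⟨h0, h1⟩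
    rw [norm_mul, Real.norm_eq_abs, Real.norm_eq_abs, abs_of_pos (Real.exp_pos _)]
    have hexp : Real.exp (-(Λ * t)) ≤ 1 := Real.exp_le_one_iff.2 (by nlinarith [mul_nonneg hΛ0 h0])
    refine (mul_le_of_le_one_left (abs_nonneg _) hexp).trans ?_
    rw [hΛ, Finset.sum_mul, ← Finset.sum_sub_distrib, hB, ← Finset.sum_add_distrib]
    exact (Finset.abs_sum_le_sum_abs _ _).trans
      (Finset.sum_le_sum fun i _ => abs_expect_mul_pow_sub_le X L hX hdep hne h0 h1 i)
  have hmvt := (convex_Icc (0 : ℝ) 1).norm_image_sub_le_of_norm_hasDerivWithin_le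
    (fun t _ => (hg' t).hasDerivWithinAt) hbound
    (Set.right_mem_Icc.2 zero_le_one) (Set.left_mem_Icc.2 zero_le_one)
  simpa [hφ, Real.norm_eq_abs] using hmvt

lemma expect_indicator_forall_mem {κ α : Type*} [Fintype κ] [DecidableEq κ] [Fintype α]
    [Nonempty α] (L : Finset κ) (T : κ → Finset α)
    [DecidablePred fun E : κ → α => ∀ j ∈ L, E j ∈ T j] :
    𝔼 E : κ → α, (if ∀ j ∈ L, E j ∈ T j then (1 : ℝ) else 0)
      = ∏ j ∈ L, ((T j).card : ℝ) / Fintype.card α := by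
  have hset : (Finset.univ.filter fun E : κ → α => ∀ j ∈ L, E j ∈ T j)
      = Fintype.piFinset fun j => if j ∈ L then T j else Finset.univ := by
    ext E
    simp only [Finset.mem_filter, Finset.mem_univ, true_and, Fintype.mem_piFinset]
    refine forall_congr' fun j => ?_
    by_cases hj : j ∈ L <;> simp [hj]
  have hN : (Fintype.card α : ℝ) ≠ 0 := by exact_mod_cast Fintype.card_ne_zero
  rw [Fintype.expect_eq_sum_div_card, Finset.sum_boole, hset, Fintype.card_piFinset,
    Fintype.card_fun, Nat.cast_prod, Nat.cast_pow, ← Finset.card_univ (α := κ),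
    ← Finset.prod_const, ← Finset.prod_div_distrib, ← Finset.prod_subset (Finset.subset_univ L)]
  · exact Finset.prod_congr rfl fun j hj => by simp [hj]
  · intro j _ hj
    simp [hj, hN]

lemma expect_indicator_comp_eq {κ β α : Type*} [Fintype κ] [DecidableEq κ] [Fintype β] [Fintype α]
    [Nonempty α] (τ : β ↪ κ) (G : β → α)
    [DecidablePred fun E : κ → α => ∀ i, E (τ i) = G i] :
    𝔼 E : κ → α, (if ∀ i, E (τ i) = G i then (1 : ℝ) else 0)
      = 1 / (Fintype.card α : ℝ) ^ Fintype.card β := by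
  have h := expect_indicator_forall_mem (Finset.univ.map τ)
    (fun j => Finset.univ.filter fun x : α => ∀ i, τ i = j → x = G i)
  have hcard : ∀ i, (Finset.univ.filter fun x : α => ∀ i', τ i' = τ i → x = G i').card = 1 := by
    intro i
    rw [Finset.card_eq_one]
    refine ⟨G i, ?_⟩
    ext x
    simp
  rw [Finset.prod_map] at h
  simp only [hcard] at h
  simpa using h

/-- Two embeddings with the same range differ by a permutation of the domain. -/
lemma exists_perm_of_range_eq {β γ : Type*} [Finite β] (σ σ' : β ↪ γ)
    (h : Set.range σ' = Set.range σ) : ∃ π : β ≃ β, ∀ i, σ' i = σ (π i) := by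
  have hex : ∀ i, ∃ i', σ i' = σ' i := fun i => by
    have : σ' i ∈ Set.range σ := h ▸ Set.mem_range_self i
    exact this
  choose f hf using hex
  have hinj : Function.Injective f := fun a b hab => σ'.injective (by rw [← hf, ← hf, hab])
  exact ⟨Equiv.ofBijective f (Finite.injective_iff_bijective.1 hinj), fun i => (hf i).symm⟩

section SubMG

variable {k l n m : ℕ} {F : Fin l → Fin k × Fin k} {E : Fin m → Fin n × Fin n}
  {p q : Finset (Fin n) × Finset (Fin m)}

lemma SubMGIso.card_fst (h : SubMGIso F E p) : p.1.card = k := by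
  obtain ⟨σ, τ, hσ, hτ, -⟩ := h
  have : p.1 = Finset.univ.map σ := by
    apply Finset.coe_injective; simpa using hσ
  simp [this]

lemma SubMGIso.card_snd (h : SubMGIso F E p) : p.2.card = l := by
  obtain ⟨σ, τ, hσ, hτ, -⟩ := h
  have : p.2 = Finset.univ.map τ := by
    apply Finset.coe_injective; simpa using hτ
  simp [this]

lemma SubMGIso.isSubMG (h : SubMGIso F E p) : IsSubMG E p := by
  obtain ⟨σ, τ, hσ, hτ, hE⟩ := h
  intro j hj
  obtain ⟨i, rfl⟩ : j ∈ Set.range τ := hτ ▸ Finset.mem_coe.2 hj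
  have hmem : ∀ v, σ v ∈ p.1 := fun v => Finset.mem_coe.1 (hσ ▸ Set.mem_range_self v)
  have := hE i
  rw [Sym2.eq_iff] at this
  rcases this with ⟨h1, h2⟩ | ⟨h1, h2⟩ <;> rw [h1, h2] <;> exact ⟨hmem _, hmem _⟩

lemma SubMGIso.congr {E' : Fin m → Fin n × Fin n} (hEE' : ∀ j ∈ p.2, E j = E' j)
    (h : SubMGIso F E p) : SubMGIso F E' p := by
  obtain ⟨σ, τ, hσ, hτ, hE⟩ := h
  refine ⟨σ, τ, hσ, hτ, fun j => ?_⟩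
  rw [← hEE' (τ j) (Finset.mem_coe.1 (hτ ▸ Set.mem_range_self j))]
  exact hE j

/-- Once vertices and edges of `p` are labeled, `p` is a copy of `F` exactly when the labeled
multigraph it induces is isomorphic to `F`. -/
lemma subMGIso_iff_exists_MGIso (σ : Fin k ↪ Fin n) (τ : Fin l ↪ Fin m)
    (hσ : (p.1 : Set (Fin n)) = Set.range σ) (hτ : (p.2 : Set (Fin m)) = Set.range τ) :
    SubMGIso F E p ↔
      ∃ E' : Fin l → Fin k × Fin k, MGIso F E' ∧ ∀ i, E (τ i) = Prod.map σ σ (E' i) := by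
  constructor
  · intro h
    have hsub := h.isSubMG
    obtain ⟨σ', τ', hσ', hτ', hE⟩ := h
    obtain ⟨π, hπ⟩ := exists_perm_of_range_eq σ σ' (hσ'.symm.trans hσ)
    obtain ⟨ρ, hρ⟩ := exists_perm_of_range_eq τ τ' (hτ'.symm.trans hτ)
    have hex : ∀ i, ∃ e : Fin k × Fin k, E (τ i) = Prod.map σ σ e := by
      intro i
      obtain ⟨h1, h2⟩ := hsub (τ i) (Finset.mem_coe.1 (hτ ▸ Set.mem_range_self i))
      rw [← Finset.mem_coe, hσ] at h1 h2
      obtain ⟨a, ha⟩ := h1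
      obtain ⟨b, hb⟩ := h2
      exact ⟨(a, b), by ext <;> simp [ha, hb]⟩
    choose E' hE' using hex
    refine ⟨E', ⟨π, ρ, fun j => ?_⟩, hE'⟩
    apply Sym2.map.injective σ.injective
    have := hE j
    rw [hρ, hE' (ρ j)] at this
    simpa [hπ] using this
  · rintro ⟨E', ⟨π, ρ, h⟩, hE'⟩
    refine ⟨π.toEmbedding.trans σ, ρ.toEmbedding.trans τ, ?_, ?_, fun j => ?_⟩
    · rw [hσ, Function.Embedding.coe_trans]
      exact (π.surjective.range_comp σ).symm
    · rw [hτ, Function.Embedding.coe_trans]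
      exact (ρ.surjective.range_comp τ).symm
    · have := congrArg (Sym2.map σ) (h j)
      simpa [hE'] using this

/-- Two distinct copies of a strictly balanced multigraph sharing an edge have a union denser
than `F`. -/
lemma SubMGIso.card_union_lt (hbal : StrictlyBalancedMG F) (hp : SubMGIso F E p)
    (hq : SubMGIso F E q) (hpq : q ≠ p) (hL : ¬ Disjoint p.2 q.2) :
    (p.1 ∪ q.1).card * l < (p.2 ∪ q.2).card * k := by
  have hcp1 := hp.card_fst
  have hcp2 := hp.card_snd
  have hcq1 := hq.card_fst
  have hcq2 := hq.card_snd
  have hqsub := hq.isSubMG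
  obtain ⟨σ, τ, hσ, hτ, hE⟩ := hp
  have hp1 : p.1 = Finset.univ.map σ := by apply Finset.coe_injective; simpa using hσ
  have hp2 : p.2 = Finset.univ.map τ := by apply Finset.coe_injective; simpa using hτ
  set S₀ : Finset (Fin k) := Finset.univ.filter fun v => σ v ∈ q.1 with hS₀
  set L₀ : Finset (Fin l) := Finset.univ.filter fun j => τ j ∈ q.2 with hL₀
  have hcS : S₀.card = (p.1 ∩ q.1).card := by
    rw [← Finset.card_map σ]
    congr 1
    ext v
    simp only [hp1, hS₀, Finset.mem_map, Finset.mem_filter, Finset.mem_univ, true_and,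
      Finset.mem_inter]
    constructor
    · rintro ⟨a, ha, rfl⟩; exact ⟨⟨a, rfl⟩, ha⟩
    · rintro ⟨⟨a, rfl⟩, ha⟩; exact ⟨a, ha, rfl⟩
  have hcL : L₀.card = (p.2 ∩ q.2).card := by
    rw [← Finset.card_map τ]
    congr 1
    ext v
    simp only [hp2, hL₀, Finset.mem_map, Finset.mem_filter, Finset.mem_univ, true_and,
      Finset.mem_inter]
    constructor
    · rintro ⟨a, ha, rfl⟩; exact ⟨⟨a, rfl⟩, ha⟩
    · rintro ⟨⟨a, rfl⟩, ha⟩; exact ⟨a, ha, rfl⟩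
  have hsub : IsSubMG F (S₀, L₀) := by
    intro j hj
    have hj' : τ j ∈ q.2 := (Finset.mem_filter.1 hj).2
    obtain ⟨h1, h2⟩ := hqsub _ hj'
    have := hE j
    rw [Sym2.eq_iff] at this
    rcases this with ⟨e1, e2⟩ | ⟨e1, e2⟩ <;> rw [e1] at h1 <;> rw [e2] at h2 <;>
      simp [hS₀, h1, h2]
  have hLne : L₀.Nonempty := by
    rw [← Finset.card_pos, hcL, Finset.card_pos]
    rwa [Finset.not_disjoint_iff_nonempty_inter] at hL
  have hSne : S₀.Nonempty := by
    obtain ⟨j, hj⟩ := hLne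
    exact ⟨_, (hsub j hj).1⟩
  have hproper : ¬ (S₀ = Finset.univ ∧ L₀ = Finset.univ) := by
    rintro ⟨h1, h2⟩
    apply hpq
    have hs : p.1 ∩ q.1 = p.1 := Finset.eq_of_subset_of_card_le Finset.inter_subset_left
      (by rw [← hcS, h1, hcp1]; simp)
    have hl : p.2 ∩ q.2 = p.2 := Finset.eq_of_subset_of_card_le Finset.inter_subset_left
      (by rw [← hcL, h2, hcp2]; simp)
    refine Prod.ext ?_ ?_
    · exact (Finset.eq_of_subset_of_card_le (Finset.inter_eq_left.1 hs) (by omega)).symm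
    · exact (Finset.eq_of_subset_of_card_le (Finset.inter_eq_left.1 hl) (by omega)).symm
  have hlt := hbal (S₀, L₀) hsub hSne hproper
  have hk : (0 : ℝ) < k := by
    obtain ⟨v, -⟩ := hSne
    exact_mod_cast v.pos
  have hs0 : (0 : ℝ) < S₀.card := by exact_mod_cast hSne.card_pos
  rw [div_lt_div_iff₀ hs0 hk, hcS, hcL] at hlt
  have hlt' : (p.2 ∩ q.2).card * k < l * (p.1 ∩ q.1).card := by exact_mod_cast hlt
  have e1 := Finset.card_union_add_card_inter p.1 q.1
  have e2 := Finset.card_union_add_card_inter p.2 q.2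
  rw [hcp1, hcq1] at e1
  rw [hcp2, hcq2] at e2
  nlinarith [congrArg (· * l) e1, congrArg (· * k) e2]

lemma countSubMG_eq_sum (F : Fin l → Fin k × Fin k) (E : Fin m → Fin n × Fin n) :
    countSubMG F E = ∑ p, if SubMGIso F E p then 1 else 0 := by
  rw [countSubMG, Finset.sum_boole, Set.ncard_eq_toFinset_card']
  simp only [Nat.cast_id]
  congr 1
  ext p
  simp only [Set.mem_toFinset, Set.mem_ofPred_eq, Finset.mem_filter, Finset.mem_univ, true_and]
  exact ⟨And.right, fun h => ⟨h.isSubMG, h⟩⟩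

lemma ncard_countSubMG_eq_zero_div (F : Fin l → Fin k × Fin k) (n m : ℕ) :
    (Set.ncard {E : Fin m → Fin n × Fin n | countSubMG F E = 0} : ℝ) / (n : ℝ) ^ (2 * m)
      = 𝔼 E : Fin m → Fin n × Fin n, (0 : ℝ) ^ (∑ p, if SubMGIso F E p then 1 else 0) := by
  simp only [← countSubMG_eq_sum, zero_pow_eq]
  rw [Fintype.expect_eq_sum_div_card, Finset.sum_boole, Set.ncard_eq_toFinset_card',
    Set.toFinset_ofPred]
  simp [pow_mul, sq]

lemma expect_subMGIso [NeZero n] (F : Fin l → Fin k × Fin k)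
    (p : Finset (Fin n) × Finset (Fin m)) :
    𝔼 E : Fin m → Fin n × Fin n, ((if SubMGIso F E p then 1 else 0 : ℕ) : ℝ)
      = if p.1.card = k ∧ p.2.card = l then
          (Set.ncard {E' : Fin l → Fin k × Fin k | MGIso F E'} : ℝ) / (n : ℝ) ^ (2 * l)
        else 0 := by
  split_ifs with h
  · obtain ⟨h1, h2⟩ := h
    set σ : Fin k ↪ Fin n := (p.1.orderEmbOfFin h1).toEmbedding
    set τ : Fin l ↪ Fin m := (p.2.orderEmbOfFin h2).toEmbedding
    have hσ : (p.1 : Set (Fin n)) = Set.range σ := (p.1.range_orderEmbOfFin h1).symm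
    have hτ : (p.2 : Set (Fin m)) = Set.range τ := (p.2.range_orderEmbOfFin h2).symm
    have hsum : ∀ E : Fin m → Fin n × Fin n, ((if SubMGIso F E p then 1 else 0 : ℕ) : ℝ)
        = ∑ E' with MGIso F E', if ∀ i, E (τ i) = Prod.map σ σ (E' i) then (1 : ℝ) else 0 := by
      intro E
      split_ifs with hE
      · obtain ⟨E', hiso, hE'⟩ := (subMGIso_iff_exists_MGIso σ τ hσ hτ).1 hE
        rw [Finset.sum_eq_single E']
        · simp [hE']
        · intro E'' _ hne
          rw [if_neg]
          intro h
          apply hne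
          funext i
          exact (σ.injective.prodMap σ.injective) ((h i).symm.trans (hE' i))
        · intro h
          exact absurd (by simpa using hiso) h
      · rw [Nat.cast_zero, Finset.sum_eq_zero]
        intro E' hE'
        rw [if_neg]
        intro h
        exact hE ((subMGIso_iff_exists_MGIso σ τ hσ hτ).2 ⟨E', (Finset.mem_filter.1 hE').2, h⟩)
    simp only [hsum]
    rw [Finset.expect_sum_comm]
    simp only [expect_indicator_comp_eq τ]
    rw [Set.ncard_eq_toFinset_card', Set.toFinset_ofPred]
    simp [div_eq_mul_inv, pow_mul, sq]
  · refine Finset.expect_eq_zero fun E _ => ?_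
    rw [if_neg fun hE => h ⟨hE.card_fst, hE.card_snd⟩, Nat.cast_zero]

lemma expect_subMGIso_mul_le [NeZero n] (hbal : StrictlyBalancedMG F)
    (hpq : q ≠ p) (hL : ¬ Disjoint p.2 q.2) :
    𝔼 E : Fin m → Fin n × Fin n, (((if SubMGIso F E p then 1 else 0 : ℕ) : ℝ) *
        ((if SubMGIso F E q then 1 else 0 : ℕ) : ℝ))
      ≤ if (p.1 ∪ q.1).card * l < (p.2 ∪ q.2).card * k ∧ (p.1 ∪ q.1).card ≤ 2 * k ∧
            (p.2 ∪ q.2).card ≤ 2 * l then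
          ((2 * k : ℝ) ^ 2 / (n : ℝ) ^ 2) ^ (p.2 ∪ q.2).card
        else 0 := by
  split_ifs with h
  · obtain ⟨-, hr, -⟩ := h
    have hbound := expect_indicator_forall_mem (α := Fin n × Fin n) (p.2 ∪ q.2)
      (fun _ => (p.1 ∪ q.1) ×ˢ (p.1 ∪ q.1))
    have hn : (0 : ℝ) < n := by exact_mod_cast Nat.pos_of_ne_zero (NeZero.ne n)
    have hr' : ((p.1 ∪ q.1).card : ℝ) ≤ 2 * k := by exact_mod_cast hr
    calc _ ≤ 𝔼 E : Fin m → Fin n × Fin n,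
          (if ∀ j ∈ p.2 ∪ q.2, E j ∈ (p.1 ∪ q.1) ×ˢ (p.1 ∪ q.1) then (1 : ℝ) else 0) := by
          refine Finset.expect_le_expect fun E _ => ?_
          by_cases hp : SubMGIso F E p
          · by_cases hq : SubMGIso F E q
            · rw [if_pos hp, if_pos hq, if_pos]
              · simp
              · intro j hj
                rw [Finset.mem_product, Finset.mem_union, Finset.mem_union]
                rcases Finset.mem_union.1 hj with hj | hj
                · exact ⟨Or.inl (hp.isSubMG j hj).1, Or.inl (hp.isSubMG j hj).2⟩
                · exact ⟨Or.inr (hq.isSubMG j hj).1, Or.inr (hq.isSubMG j hj).2⟩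
            · rw [if_neg hq]; split_ifs <;> simp
          · rw [if_neg hp]; split_ifs <;> simp
      _ = (((p.1 ∪ q.1).card : ℝ) ^ 2 / (n : ℝ) ^ 2) ^ (p.2 ∪ q.2).card := by
          rw [hbound, Finset.prod_const, Finset.card_product]; simp [sq]
      _ ≤ _ := by gcongr
  · refine (Finset.expect_eq_zero fun E _ => ?_).le
    by_cases hp : SubMGIso F E p
    · by_cases hq : SubMGIso F E q
      · refine absurd ⟨hp.card_union_lt hbal hq hpq hL, ?_, ?_⟩ h
        · have := Finset.card_union_le p.1 q.1
          rw [hp.card_fst, hq.card_fst] at this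
          omega
        · have := Finset.card_union_le p.2 q.2
          rw [hp.card_snd, hq.card_snd] at this
          omega
      · simp [hq]
    · simp [hp]

end SubMG

lemma card_filter_card_union_eq_le (α : Type*) [Fintype α] [DecidableEq α] (r : ℕ) :
    (Finset.univ.filter fun x : Finset α × Finset α => (x.1 ∪ x.2).card = r).card
      ≤ (4 * Fintype.card α) ^ r := by
  have hsub : (Finset.univ.filter fun x : Finset α × Finset α => (x.1 ∪ x.2).card = r)
      ⊆ (Finset.powersetCard r Finset.univ).biUnion fun U => U.powerset ×ˢ U.powerset := by
    intro x hx
    rw [Finset.mem_biUnion]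
    refine ⟨x.1 ∪ x.2, ?_, ?_⟩
    · simpa [Finset.mem_powersetCard] using hx
    · rw [Finset.mem_product, Finset.mem_powerset, Finset.mem_powerset]
      exact ⟨Finset.subset_union_left, Finset.subset_union_right⟩
  calc _ ≤ _ := Finset.card_le_card hsub
    _ ≤ (Finset.powersetCard r (Finset.univ : Finset α)).card * 4 ^ r := by
        refine Finset.card_biUnion_le_card_mul _ _ _ fun U hU => ?_
        rw [Finset.card_product, Finset.card_powerset, (Finset.mem_powersetCard.1 hU).2,
          ← mul_pow]
        norm_num
    _ ≤ Fintype.card α ^ r * 4 ^ r := by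
        rw [Finset.card_powersetCard, Finset.card_univ]
        gcongr
        exact Nat.choose_le_pow _ _
    _ = _ := by rw [mul_pow, mul_comm]

lemma sum_card_union_le (α : Type*) [Fintype α] [DecidableEq α] (R : ℕ) (g : ℕ → ℝ)
    (hg : ∀ r, 0 ≤ g r) (hR : ∀ r, R ≤ r → g r = 0) :
    ∑ S : Finset α, ∑ S' : Finset α, g (S ∪ S').card
      ≤ ∑ r ∈ Finset.range R, (4 * Fintype.card α : ℝ) ^ r * g r := by
  have hexpand : ∀ x, g x = ∑ r ∈ Finset.range R, if x = r then g r else 0 := by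
    intro x
    rw [Finset.sum_ite_eq]
    split_ifs with h
    · rfl
    · exact hR x (by simpa using h)
  rw [← Fintype.sum_prod_type' fun S S' : Finset α => g (S ∪ S').card]
  simp only [hexpand (Finset.card _)]
  rw [Finset.sum_comm]
  refine Finset.sum_le_sum fun r _ => ?_
  rw [← Finset.sum_filter, Finset.sum_const, nsmul_eq_mul]
  refine mul_le_mul_of_nonneg_right ?_ (hg r)
  exact_mod_cast card_filter_card_union_eq_le α r

lemma sum_card_union_card_union_le (n m R U : ℕ) (G : ℕ → ℕ → ℝ) (hG : ∀ r u, 0 ≤ G r u)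
    (hR : ∀ r u, R ≤ r → G r u = 0) (hU : ∀ r u, U ≤ u → G r u = 0) :
    ∑ p : Finset (Fin n) × Finset (Fin m), ∑ q : Finset (Fin n) × Finset (Fin m),
        G (p.1 ∪ q.1).card (p.2 ∪ q.2).card
      ≤ ∑ r ∈ Finset.range R, ∑ u ∈ Finset.range U,
          (4 * n : ℝ) ^ r * ((4 * m : ℝ) ^ u * G r u) := by
  have h1 := sum_card_union_le (Fin n) R
    (fun r => ∑ u ∈ Finset.range U, (4 * m : ℝ) ^ u * G r u)
    (fun r => Finset.sum_nonneg fun u _ => mul_nonneg (by positivity) (hG r u))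
    (fun r hr => Finset.sum_eq_zero fun u _ => by rw [hR r u hr, mul_zero])
  simp only [Fintype.card_fin, Finset.mul_sum] at h1
  refine le_trans ?_ h1
  simp only [Fintype.sum_prod_type]
  refine Finset.sum_le_sum fun S _ => ?_
  rw [Finset.sum_comm]
  refine Finset.sum_le_sum fun S' _ => ?_
  simpa using sum_card_union_le (Fin m) U (fun u => G (S ∪ S').card u) (hG _) (hU _)

/-- Explicit Poisson approximation for the probability that a random `(n,m)`-multigraph is free of
a strictly balanced multigraph. -/
lemma abs_ncard_div_sub_exp_le {k l : ℕ} (F : Fin l → Fin k × Fin k) (hl : 1 ≤ l)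
    (hbal : StrictlyBalancedMG F) (n m a : ℕ) (hn : n ≠ 0)
    (ha : a = Set.ncard {E' : Fin l → Fin k × Fin k | MGIso F E'}) :
    |(Set.ncard {E : Fin m → Fin n × Fin n | countSubMG F E = 0} : ℝ) / (n : ℝ) ^ (2 * m)
        - Real.exp (-(n.choose k * m.choose l * (a / (n : ℝ) ^ (2 * l))))|
      ≤ (∑ r ∈ Finset.range (2 * k + 1), ∑ u ∈ Finset.range (2 * l),
          (4 * n : ℝ) ^ r * ((4 * m : ℝ) ^ u * (a / (n : ℝ) ^ (2 * l)) ^ 2))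
        + ∑ r ∈ Finset.range (2 * k + 1), ∑ u ∈ Finset.range (2 * l + 1),
          (4 * n : ℝ) ^ r * ((4 * m : ℝ) ^ u *
            if r * l < u * k then ((2 * k : ℝ) ^ 2 / (n : ℝ) ^ 2) ^ u else 0) := by
  have : NeZero n := ⟨hn⟩
  have hmean : ∀ p : Finset (Fin n) × Finset (Fin m), _ := fun p => expect_subMGIso F p
  rw [← ha] at hmean
  have hstein := abs_expect_zero_pow_sub_exp_le
    (fun (p : Finset (Fin n) × Finset (Fin m)) E => if SubMGIso F E p then 1 else 0)
    (fun p => p.2) (fun p E => by split_ifs <;> simp)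
    (fun p E E' h => if_congr ⟨fun hE => hE.congr h,
      fun hE => hE.congr fun j hj => (h j hj).symm⟩ rfl rfl)
    (fun p E h => by
      have hE : SubMGIso F E p := by by_contra hE; simp [hE] at h
      rw [← Finset.card_pos, hE.card_snd]
      exact hl)
  rw [← ncard_countSubMG_eq_zero_div] at hstein
  have hmeansum : ∑ p : Finset (Fin n) × Finset (Fin m),
      𝔼 E : Fin m → Fin n × Fin n, ((if SubMGIso F E p then 1 else 0 : ℕ) : ℝ)
        = n.choose k * m.choose l * (a / (n : ℝ) ^ (2 * l)) := by
    simp only [hmean]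
    rw [← Finset.sum_filter, Finset.sum_const, nsmul_eq_mul]
    have : (Finset.univ.filter fun p : Finset (Fin n) × Finset (Fin m) =>
        p.1.card = k ∧ p.2.card = l)
        = Finset.powersetCard k Finset.univ ×ˢ Finset.powersetCard l Finset.univ := by
      ext p; simp [Finset.mem_powersetCard]
    rw [this, Finset.card_product]
    simp
  rw [hmeansum] at hstein
  refine hstein.trans (add_le_add ?_ ?_)
  · let G : ℕ → ℕ → ℝ := fun r u =>
      if r < 2 * k + 1 ∧ u < 2 * l then (a / (n : ℝ) ^ (2 * l)) ^ 2 else 0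
    have hG : ∀ r u, 0 ≤ G r u := fun r u => by dsimp only [G]; split_ifs <;> positivity
    refine le_trans ?_ ((sum_card_union_card_union_le n m (2 * k + 1) (2 * l) G hG ?_ ?_).trans ?_)
    · refine Finset.sum_le_sum fun p _ => ?_
      rw [Finset.sum_filter]
      refine Finset.sum_le_sum fun q _ => ?_
      by_cases hd : ¬ Disjoint p.2 q.2
      · rw [if_pos hd, hmean, hmean]
        by_cases hp : p.1.card = k ∧ p.2.card = l
        · by_cases hq : q.1.card = k ∧ q.2.card = l
          · have h1 := Finset.card_union_le p.1 q.1
            have h2 := Finset.card_union_add_card_inter p.2 q.2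
            have h3 := (Finset.not_disjoint_iff_nonempty_inter.1 hd).card_pos
            have : G (p.1 ∪ q.1).card (p.2 ∪ q.2).card = (a / (n : ℝ) ^ (2 * l)) ^ 2 :=
              if_pos ⟨by omega, by omega⟩
            rw [if_pos hp, if_pos hq, this, sq]
          · rw [if_neg hq, mul_zero]; exact hG _ _
        · rw [if_neg hp, zero_mul]; exact hG _ _
      · rw [if_neg hd]; exact hG _ _
    · exact fun r u h => if_neg (by omega)
    · exact fun r u h => if_neg (by omega)
    · refine Finset.sum_le_sum fun r hr => Finset.sum_le_sum fun u hu => ?_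
      have : G r u = (a / (n : ℝ) ^ (2 * l)) ^ 2 :=
        if_pos ⟨Finset.mem_range.1 hr, Finset.mem_range.1 hu⟩
      rw [this]
  · let G : ℕ → ℕ → ℝ := fun r u =>
      if r * l < u * k ∧ r ≤ 2 * k ∧ u ≤ 2 * l then ((2 * k : ℝ) ^ 2 / (n : ℝ) ^ 2) ^ u else 0
    have hG : ∀ r u, 0 ≤ G r u := fun r u => by dsimp only [G]; split_ifs <;> positivity
    refine le_trans ?_
      ((sum_card_union_card_union_le n m (2 * k + 1) (2 * l + 1) G hG ?_ ?_).trans ?_)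
    · refine Finset.sum_le_sum fun p _ => ?_
      rw [Finset.sum_filter]
      refine Finset.sum_le_sum fun q _ => ?_
      split_ifs with hd
      · exact expect_subMGIso_mul_le hbal hd.2 hd.1
      · exact hG _ _
    · exact fun r u h => if_neg (by omega)
    · exact fun r u h => if_neg (by omega)
    · refine Finset.sum_le_sum fun r hr => Finset.sum_le_sum fun u hu => ?_
      rw [Finset.mem_range] at hr hu
      have : G r u = if r * l < u * k then ((2 * k : ℝ) ^ 2 / (n : ℝ) ^ 2) ^ u else 0 :=
        if_congr ⟨And.left, fun h => ⟨h, by omega, by omega⟩⟩ rfl rfl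
      rw [this]

lemma tendsto_sum_sum_zero {β γ δ : Type*} {ℓ : Filter δ} (s : Finset β) (t : Finset γ)
    (f : δ → β → γ → ℝ) (h : ∀ r ∈ s, ∀ u ∈ t, Tendsto (fun n => f n r u) ℓ (nhds 0)) :
    Tendsto (fun n => ∑ r ∈ s, ∑ u ∈ t, f n r u) ℓ (nhds 0) := by
  simpa using tendsto_finsetSum s fun r hr => tendsto_finsetSum t fun u hu => h r hr u hu

section Threshold

variable {k l : ℕ} {c : ℝ} {m : ℕ → ℕ}

lemma eventually_pow_mul_div_pow_eq (m : ℕ → ℕ) (e : ℝ) (r u : ℕ) :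
    ∀ᶠ n : ℕ in atTop, (n : ℝ) ^ r * ((m n : ℝ) / (n : ℝ) ^ 2) ^ u
      = ((m n : ℝ) / (n : ℝ) ^ (2 - e)) ^ u * (n : ℝ) ^ (r - u * e) := by
  filter_upwards [eventually_gt_atTop 0] with n hn
  have hn' : (0 : ℝ) < n := by exact_mod_cast hn
  have h1 : (n : ℝ) ^ (2 - e) = (n : ℝ) ^ 2 / (n : ℝ) ^ e := by
    rw [Real.rpow_sub hn', Real.rpow_two]
  have h2 : (n : ℝ) ^ (r - u * e) = (n : ℝ) ^ r / ((n : ℝ) ^ e) ^ u := by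
    rw [Real.rpow_sub hn', Real.rpow_natCast, mul_comm, Real.rpow_mul hn'.le, Real.rpow_natCast]
  have he : (n : ℝ) ^ e ≠ 0 := (Real.rpow_pos_of_pos hn' e).ne'
  rw [h1, h2, div_div_eq_mul_div, div_pow, div_pow, mul_pow]
  field_simp

lemma tendsto_pow_mul_div_pow_of_lt (hl : 1 ≤ l)
    (hm : Tendsto (fun n : ℕ => (m n : ℝ) / (n : ℝ) ^ ((2 : ℝ) - k / l)) atTop (nhds c))
    {r u : ℕ} (h : r * l < u * k) :
    Tendsto (fun n : ℕ => (n : ℝ) ^ r * ((m n : ℝ) / (n : ℝ) ^ 2) ^ u) atTop (nhds 0) := by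
  rw [tendsto_congr' (eventually_pow_mul_div_pow_eq m (k / l) r u), ← mul_zero (c ^ u)]
  refine (hm.pow u).mul ?_
  have hl' : (0 : ℝ) < l := by exact_mod_cast hl
  have hpos : 0 < (u : ℝ) * (k / l) - r := by
    rw [sub_pos, ← mul_div_assoc, lt_div_iff₀ hl']
    exact_mod_cast h
  simpa [Function.comp_def] using (tendsto_rpow_neg_atTop hpos).comp tendsto_natCast_atTop_atTop

lemma tendsto_pow_mul_div_pow (hl : 1 ≤ l)
    (hm : Tendsto (fun n : ℕ => (m n : ℝ) / (n : ℝ) ^ ((2 : ℝ) - k / l)) atTop (nhds c)) :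
    Tendsto (fun n : ℕ => (n : ℝ) ^ k * ((m n : ℝ) / (n : ℝ) ^ 2) ^ l) atTop (nhds (c ^ l)) := by
  rw [tendsto_congr' (eventually_pow_mul_div_pow_eq m (k / l) k l)]
  have hl' : (l : ℝ) ≠ 0 := by positivity
  have : (k : ℝ) - l * (k / l) = 0 := by field_simp; ring
  simpa [this] using hm.pow l

lemma tendsto_choose_div_pow (k : ℕ) :
    Tendsto (fun n : ℕ => (n.choose k : ℝ) / (n : ℝ) ^ k) atTop (nhds (1 / k.factorial)) := by
  have h := (isEquivalent_choose k).mul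
    (IsEquivalent.refl (u := fun n : ℕ => ((n : ℝ) ^ k)⁻¹) (l := atTop))
  refine (h.symm.tendsto_nhds ?_)
  refine tendsto_const_nhds.congr' ?_
  filter_upwards [eventually_gt_atTop 0] with n hn
  have hn' : (n : ℝ) ^ k ≠ 0 := by positivity
  simp only [Pi.mul_apply]
  field_simp

lemma tendsto_choose_mul_choose (hl : 1 ≤ l) (hminf : Tendsto m atTop atTop)
    (hm : Tendsto (fun n : ℕ => (m n : ℝ) / (n : ℝ) ^ ((2 : ℝ) - k / l)) atTop (nhds c)) (a : ℕ) :
    Tendsto (fun n : ℕ => ((n.choose k : ℝ) * (m n).choose l * (a / (n : ℝ) ^ (2 * l)))) atTop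
      (nhds (a * c ^ l / (k.factorial * l.factorial))) := by
  have h := (((tendsto_choose_div_pow k).mul ((tendsto_choose_div_pow l).comp hminf)).mul
    (tendsto_pow_mul_div_pow hl hm)).const_mul (a : ℝ)
  have hlim : (a : ℝ) * (1 / k.factorial * (1 / l.factorial) * c ^ l)
      = a * c ^ l / (k.factorial * l.factorial) := by
    have h1 := k.factorial_ne_zero
    have h2 := l.factorial_ne_zero
    field_simp
  rw [hlim] at h
  refine h.congr' ?_
  filter_upwards [eventually_gt_atTop 0, hminf.eventually_gt_atTop 0] with n hn hmn
  have hn' : (n : ℝ) ≠ 0 := by positivity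
  have hm' : (m n : ℝ) ≠ 0 := by positivity
  simp only [Function.comp_apply]
  rw [pow_mul, div_pow]
  field_simp

lemma tendsto_product_error_term (hl : 1 ≤ l) (hminf : Tendsto m atTop atTop)
    (hm : Tendsto (fun n : ℕ => (m n : ℝ) / (n : ℝ) ^ ((2 : ℝ) - k / l)) atTop (nhds c)) (a : ℕ)
    {r u : ℕ} (hr : r ≤ 2 * k) (hu : u < 2 * l) :
    Tendsto (fun n : ℕ =>
      (4 * n : ℝ) ^ r * ((4 * m n : ℝ) ^ u * (a / (n : ℝ) ^ (2 * l)) ^ 2)) atTop (nhds 0) := by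
  have hlim : Tendsto (fun n : ℕ => 4 ^ r * 4 ^ u * (a : ℝ) ^ 2 *
      (((n : ℝ) ^ k * ((m n : ℝ) / (n : ℝ) ^ 2) ^ l) ^ 2 * (m n : ℝ)⁻¹)) atTop (nhds 0) := by
    have hinv : Tendsto (fun n => ((m n : ℝ))⁻¹) atTop (nhds 0) :=
      tendsto_inv_atTop_zero.comp (tendsto_natCast_atTop_atTop.comp hminf)
    simpa using (((tendsto_pow_mul_div_pow hl hm).pow 2).mul hinv).const_mul
      (4 ^ r * 4 ^ u * (a : ℝ) ^ 2)
  refine squeeze_zero' (Eventually.of_forall fun n => by positivity) ?_ hlim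
  filter_upwards [eventually_gt_atTop 0, hminf.eventually_gt_atTop 0] with n hn hmn
  have hn' : (0 : ℝ) < n := by exact_mod_cast hn
  have hm' : (0 : ℝ) < m n := by exact_mod_cast hmn
  have hn1 : (1 : ℝ) ≤ n := by exact_mod_cast hn
  have hm1 : (1 : ℝ) ≤ m n := by exact_mod_cast hmn
  have hrn : (n : ℝ) ^ r ≤ (n : ℝ) ^ (2 * k) := pow_le_pow_right₀ hn1 hr
  have hum : (m n : ℝ) ^ u ≤ (m n : ℝ) ^ (2 * l) * (m n : ℝ)⁻¹ := by
    rw [← div_eq_mul_inv, le_div_iff₀ hm', ← pow_succ]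
    exact pow_le_pow_right₀ hm1 hu
  calc (4 * n : ℝ) ^ r * ((4 * m n : ℝ) ^ u * (a / (n : ℝ) ^ (2 * l)) ^ 2)
      = 4 ^ r * 4 ^ u * (a / (n : ℝ) ^ (2 * l)) ^ 2 * ((n : ℝ) ^ r * (m n : ℝ) ^ u) := by
        rw [mul_pow, mul_pow]; ring
    _ ≤ 4 ^ r * 4 ^ u * (a / (n : ℝ) ^ (2 * l)) ^ 2 *
          ((n : ℝ) ^ (2 * k) * ((m n : ℝ) ^ (2 * l) * (m n : ℝ)⁻¹)) := by gcongr
    _ = _ := by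
        rw [div_pow, div_pow, ← pow_mul, mul_pow, div_pow, ← pow_mul, ← pow_mul, ← pow_mul,
          mul_comm k 2, mul_comm l 2]
        ring

lemma tendsto_overlap_error_term (hl : 1 ≤ l)
    (hm : Tendsto (fun n : ℕ => (m n : ℝ) / (n : ℝ) ^ ((2 : ℝ) - k / l)) atTop (nhds c))
    (r u : ℕ) :
    Tendsto (fun n : ℕ => (4 * n : ℝ) ^ r * ((4 * m n : ℝ) ^ u *
      if r * l < u * k then ((2 * k : ℝ) ^ 2 / (n : ℝ) ^ 2) ^ u else 0)) atTop (nhds 0) := by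
  split_ifs with h
  · have := (tendsto_pow_mul_div_pow_of_lt hl hm h).const_mul
      (4 ^ r * 4 ^ u * ((2 * k : ℝ) ^ 2) ^ u)
    rw [mul_zero] at this
    refine this.congr fun n => ?_
    simp only [mul_pow, div_pow]
    ring
  · simp

end Threshold

/-- the number of F-free (n, m(n))-multigraphs, for a strictly
balanced multigraph F at the threshold m(n) ~ c n^(2 − 1/d), is asymptotically
e^(−λ) · n^(2 m(n)), with λ = a_F c^(m(F)) / (n(F)!·m(F)!). -/
theorem stmt11 {kF lF : ℕ} (F : Fin lF → Fin kF × Fin kF) (hlF : 1 ≤ lF)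
    (hbal : StrictlyBalancedMG F)
    (d : ℝ) (hd : d = (lF : ℝ) / kF)
    (aF : ℕ) (haF : aF = Set.ncard {E' : Fin lF → Fin kF × Fin kF | MGIso F E'})
    (c : ℝ) (hc : 0 < c)
    (m : ℕ → ℕ) (hminf : Tendsto m atTop atTop)
    (hm : Tendsto (fun n : ℕ => (m n : ℝ) / (n : ℝ) ^ ((2 : ℝ) - 1 / d)) atTop (nhds c))
    (lam : ℝ) (hlam : lam = aF * c ^ lF / (kF.factorial * lF.factorial)) :
    Tendsto (fun n : ℕ =>
        (Set.ncard {E : Fin (m n) → Fin n × Fin n | countSubMG F E = 0} : ℝ) /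
          (n : ℝ) ^ (2 * m n)) atTop (nhds (Real.exp (-lam))) := by
  have he : 1 / d = (kF : ℝ) / lF := by rw [hd, one_div_div]
  rw [he] at hm
  set Λ : ℕ → ℝ := fun n => (n.choose kF : ℝ) * (m n).choose lF * (aF / (n : ℝ) ^ (2 * lF))
  have hΛlim : Tendsto (fun n => Real.exp (-Λ n)) atTop (nhds (Real.exp (-lam))) := by
    rw [hlam]
    exact (Real.continuous_exp.tendsto _).comp (tendsto_choose_mul_choose hlF hminf hm aF).neg
  have herr : Tendsto (fun n : ℕ =>
      (∑ r ∈ Finset.range (2 * kF + 1), ∑ u ∈ Finset.range (2 * lF),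
          (4 * n : ℝ) ^ r * ((4 * m n : ℝ) ^ u * (aF / (n : ℝ) ^ (2 * lF)) ^ 2))
        + ∑ r ∈ Finset.range (2 * kF + 1), ∑ u ∈ Finset.range (2 * lF + 1),
          (4 * n : ℝ) ^ r * ((4 * m n : ℝ) ^ u *
            if r * lF < u * kF then ((2 * kF : ℝ) ^ 2 / (n : ℝ) ^ 2) ^ u else 0))
      atTop (nhds 0) := by
    have hsum := (tendsto_sum_sum_zero (Finset.range (2 * kF + 1)) (Finset.range (2 * lF)) _
      fun r hr u hu => tendsto_product_error_term hlF hminf hm aF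
        (Nat.lt_succ_iff.1 (Finset.mem_range.1 hr)) (Finset.mem_range.1 hu)).add
      (tendsto_sum_sum_zero (Finset.range (2 * kF + 1)) (Finset.range (2 * lF + 1)) _
        fun r _ u _ => tendsto_overlap_error_term hlF hm r u)
    rwa [add_zero (0 : ℝ)] at hsum
  have hdiff := squeeze_zero_norm' (f := fun n : ℕ =>
    (Set.ncard {E : Fin (m n) → Fin n × Fin n | countSubMG F E = 0} : ℝ) / (n : ℝ) ^ (2 * m n)
      - Real.exp (-Λ n)) (by
    filter_upwards [eventually_ne_atTop 0] with n hn
    exact abs_ncard_div_sub_exp_le F hlF hbal n (m n) aF hn haF) herr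
  simpa using hdiff.add hΛlim
end

section
/- Let F be a strictly balanced simple graph with density d, l ≥ 1 edges, and aut(F) automorphisms (graph automorphisms of F). Let c > 0 and let m = m(n) be a sequence of integers with m(n) → ∞, m(n) ≤ choose(n,2) for all n, and m(n)/n^{2 − 1/d} → c. Then the number of (n, m(n))-graphs that contain no subgraph isomorphic to F is asymptotically equal to e^{−λ} · choose(choose(n,2), m(n)), where λ = (2c)^l / aut(F); that is, the ratio of the number of F-free (n, m(n))-graphs to choose(choose(n,2), m(n)) converges to e^{−λ}. -/
open scoped Classical
open Filter Asymptotics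

/-- `p = (V, E)` is a subgraph of the simple graph `G`: every edge of `p` is an
edge of `G` and both endpoints of every edge of `p` lie in `V`. -/
def IsSubgraphPair {n : ℕ} (G : SimpleGraph (Fin n))
    (p : Finset (Fin n) × Finset (Sym2 (Fin n))) : Prop :=
  (∀ e ∈ p.2, e ∈ G.edgeSet) ∧ ∀ e ∈ p.2, ∀ v ∈ e, v ∈ p.1

/-- The subgraph pair `p` is isomorphic to the simple graph `F`. -/
def SubgraphIso {k n : ℕ} (F : SimpleGraph (Fin k))
    (p : Finset (Fin n) × Finset (Sym2 (Fin n))) : Prop :=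
  ∃ σ : Fin k ↪ Fin n, (p.1 : Set (Fin n)) = Set.range σ ∧
    (p.2 : Set (Sym2 (Fin n))) = Sym2.map σ '' F.edgeSet

/-- The number `G[F]` of subgraphs of `G` isomorphic to `F`. -/
noncomputable def countSubSG {k n : ℕ} (F : SimpleGraph (Fin k))
    (G : SimpleGraph (Fin n)) : ℕ :=
  Set.ncard {p : Finset (Fin n) × Finset (Sym2 (Fin n)) |
    IsSubgraphPair G p ∧ SubgraphIso F p}

/-- `F` is strictly balanced: its density exceeds that of every nonempty proper
subgraph. -/
def StrictlyBalancedSG {k : ℕ} (F : SimpleGraph (Fin k)) : Prop :=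
  ∀ p : Finset (Fin k) × Finset (Sym2 (Fin k)), IsSubgraphPair F p → p.1.Nonempty →
    ¬((p.1 : Set (Fin k)) = Set.univ ∧ (p.2 : Set (Sym2 (Fin k))) = F.edgeSet) →
    (p.2.card : ℝ) / p.1.card < (F.edgeSet.ncard : ℝ) / k

/-- The probability that a uniformly random `m`-subset of an `N`-set contains a given `u`-subset. -/
noncomputable def inclProb (N m u : ℕ) : ℝ :=
  (m.descFactorial u : ℝ) / N.descFactorial u

lemma inclProb_nonneg (N m u : ℕ) : 0 ≤ inclProb N m u := by
  unfold inclProb; positivity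

lemma inclProb_succ (N m u : ℕ) :
    inclProb N m (u + 1) = ((m - u : ℕ) : ℝ) / (N - u : ℕ) * inclProb N m u := by
  unfold inclProb
  rw [Nat.descFactorial_succ, Nat.descFactorial_succ]
  push_cast
  rw [mul_div_mul_comm]

lemma sub_div_sub_le_div {N m : ℕ} (h : m ≤ N) (u : ℕ) :
    ((m - u : ℕ) : ℝ) / (N - u : ℕ) ≤ (m : ℝ) / N := by
  rcases le_or_gt m u with hu | hu
  · rw [Nat.sub_eq_zero_of_le hu]
    simp only [Nat.cast_zero, zero_div]
    positivity
  · have hu' : (u : ℝ) < m := by exact_mod_cast hu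
    have h' : (m : ℝ) ≤ N := by exact_mod_cast h
    have hu0 : (0 : ℝ) ≤ u := u.cast_nonneg
    rw [Nat.cast_sub hu.le, Nat.cast_sub (hu.le.trans h),
      div_le_div_iff₀ (by linarith) (by linarith)]
    nlinarith

lemma inclProb_add_le {N m : ℕ} (h : m ≤ N) (u a : ℕ) :
    inclProb N m (u + a) ≤ inclProb N m u * ((m : ℝ) / N) ^ a := by
  induction a with
  | zero => simp
  | succ a ih =>
    rw [← add_assoc, inclProb_succ, pow_succ, ← mul_assoc, mul_comm]
    exact mul_le_mul ih (sub_div_sub_le_div h _) (by positivity)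
      (mul_nonneg (inclProb_nonneg _ _ _) (by positivity))

lemma card_filter_superset_eq {α : Type*} [DecidableEq α] {T U : Finset α} (hU : U ⊆ T) (m : ℕ) :
    (((T.powersetCard m).filter (U ⊆ ·)).card : ℝ) =
      (T.card.choose m : ℝ) * inclProb T.card m U.card := by
  have hUT := Finset.card_le_card hU
  have hpos : (T.card.descFactorial U.card : ℝ) ≠ 0 := by
    exact_mod_cast (Nat.pos_of_ne_zero fun h0 => by
      rw [Nat.descFactorial_eq_zero_iff_lt] at h0; omega).ne'
  unfold inclProb
  rcases le_or_gt U.card m with h | h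
  · rw [Finset.card_filter_powersetCard_subset U T m hU h, ← mul_div_assoc, eq_div_iff hpos]
    have := Nat.choose_mul (n := T.card) h
    rw [Nat.descFactorial_eq_factorial_mul_choose, Nat.descFactorial_eq_factorial_mul_choose]
    have e : (T.card.choose m : ℝ) * m.choose U.card =
        T.card.choose U.card * (T.card - U.card).choose (m - U.card) := by exact_mod_cast this
    push_cast
    linear_combination (-(U.card.factorial : ℝ)) * e
  · rw [Nat.descFactorial_eq_zero_iff_lt.2 h, Finset.filter_eq_empty_iff.2]
    · simp
    · intro H hH hUH
      have := Finset.card_le_card hUH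
      rw [Finset.mem_powersetCard] at hH
      omega

lemma abs_indicator_sub_alternating_sum_le (X R : ℕ) :
    |(if X = 0 then 1 else 0 : ℝ) -
        ∑ r ∈ Finset.range R, (-1) ^ r * ((X.descFactorial r : ℝ) / r.factorial)| ≤
      (X.descFactorial R : ℝ) / R.factorial := by
  have key (r : ℕ) : (X.descFactorial r : ℝ) / r.factorial = (X.choose r : ℝ) := by
    rw [Nat.descFactorial_eq_factorial_mul_choose, Nat.cast_mul,
      mul_div_cancel_left₀ _ (by positivity)]
  simp only [key]
  rcases R with _ | R
  · split_ifs <;> simp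
  rcases X with _ | X
  · rw [Finset.sum_range_succ']
    simp
  · have h := @Int.alternating_sum_range_choose_eq_choose X R
    have h' : ∑ r ∈ Finset.range (R + 1), (-1 : ℝ) ^ r * ((X + 1).choose r : ℝ) =
        (-1) ^ R * X.choose R := by exact_mod_cast h
    rw [h', if_neg (by omega), zero_sub, abs_neg, abs_mul, abs_pow, abs_neg, abs_one, one_pow,
      one_mul, Nat.abs_cast, Nat.choose_succ_succ]
    push_cast
    linarith [(X.choose (R + 1)).cast_nonneg (α := ℝ)]

/-- Method of factorial moments for the event `X = 0`. -/
lemma tendsto_card_filter_eq_zero_div {β : ℕ → Type*} (Ω : ∀ n, Finset (β n))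
    (X : ∀ n, β n → ℕ) (lam : ℝ)
    (h : ∀ r : ℕ, Tendsto (fun n => (∑ H ∈ Ω n, ((X n H).descFactorial r : ℝ)) / (Ω n).card)
      atTop (nhds (lam ^ r))) :
    Tendsto (fun n => (((Ω n).filter (X n · = 0)).card : ℝ) / (Ω n).card) atTop
      (nhds (Real.exp (-lam))) := by
  set P : ℕ → ℝ := fun n => (((Ω n).filter (X n · = 0)).card : ℝ) / (Ω n).card
  set a : ℕ → ℕ → ℝ := fun r n => (∑ H ∈ Ω n, ((X n H).descFactorial r : ℝ)) / (Ω n).card with ha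
  have bound (R n : ℕ) : |P n - ∑ r ∈ Finset.range R, (-1) ^ r * (a r n / r.factorial)| ≤
      a R n / R.factorial := by
    have e : P n - ∑ r ∈ Finset.range R, (-1) ^ r * (a r n / r.factorial) =
        (∑ H ∈ Ω n, ((if X n H = 0 then 1 else 0 : ℝ) - ∑ r ∈ Finset.range R,
          (-1) ^ r * (((X n H).descFactorial r : ℝ) / r.factorial))) / (Ω n).card := by
      rw [Finset.sum_sub_distrib, sub_div, Finset.sum_boole, Finset.sum_comm, Finset.sum_div]
      congr 1
      refine Finset.sum_congr rfl fun r _ => ?_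
      rw [← Finset.mul_sum, ← Finset.sum_div, ha]
      ring
    have e' : a R n / R.factorial =
        (∑ H ∈ Ω n, ((X n H).descFactorial R : ℝ) / R.factorial) / (Ω n).card := by
      rw [← Finset.sum_div, ha]
      ring
    rw [e, e', abs_div, Nat.abs_cast]
    gcongr
    exact (Finset.abs_sum_le_sum_abs _ _).trans
      (Finset.sum_le_sum fun H _ => abs_indicator_sub_alternating_sum_le _ _)
  have hexp : Tendsto (fun R => ∑ r ∈ Finset.range R, (-lam) ^ r / r.factorial) atTop
      (nhds (Real.exp (-lam))) := by
    rw [Real.exp_eq_exp_ℝ]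
    exact (NormedSpace.expSeries_div_hasSum_exp (-lam)).tendsto_sum_nat
  have hfac := FloorSemiring.tendsto_pow_div_factorial_atTop lam
  rw [Metric.tendsto_atTop]
  intro ε hε
  obtain ⟨R, hR1, hR2⟩ := ((hexp.eventually (Metric.ball_mem_nhds _ (half_pos (half_pos hε)))).and
    (hfac.eventually (gt_mem_nhds (half_pos (half_pos hε))))).exists
  have t1 : Tendsto (fun n => ∑ r ∈ Finset.range R, (-1) ^ r * (a r n / r.factorial)) atTop
      (nhds (∑ r ∈ Finset.range R, (-lam) ^ r / r.factorial)) := by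
    refine tendsto_finsetSum _ fun r _ => ?_
    have e : (-lam) ^ r / r.factorial = (-1) ^ r * (lam ^ r / r.factorial) := by
      rw [neg_pow]; ring
    rw [e]
    exact ((h r).div_const _).const_mul _
  have t2 := ((h R).div_const (R.factorial : ℝ)).eventually (gt_mem_nhds hR2)
  obtain ⟨n₀, hn₀⟩ := eventually_atTop.1
    ((t1.eventually (Metric.ball_mem_nhds _ (half_pos (half_pos hε)))).and t2)
  refine ⟨n₀, fun n hn => ?_⟩
  obtain ⟨h1, h2⟩ := hn₀ n hn
  have hb := bound R n
  rw [Real.dist_eq, abs_lt] at h1 hR1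
  rw [Real.dist_eq]
  rw [abs_le] at hb
  rw [abs_lt]
  have h2' : a R n / R.factorial < ε / 2 / 2 := h2
  constructor <;> linarith [hb.1, hb.2, h1.1, h1.2, hR1.1, hR1.2]

section Embeddings

variable {k n : ℕ} (F : SimpleGraph (Fin k))

/-- The vertex set of the copy of `F` given by an embedding `σ`. -/
def embVerts (σ : Fin k ↪ Fin n) : Finset (Fin n) := Finset.univ.map σ

/-- The edge set of the copy of `F` given by an embedding `σ`. -/
noncomputable def embEdges (σ : Fin k ↪ Fin n) : Finset (Sym2 (Fin n)) :=
  F.edgeFinset.map σ.sym2Map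

/-- The copy of `F` given by an embedding `σ`. -/
noncomputable def embCopy (σ : Fin k ↪ Fin n) : Finset (Fin n) × Finset (Sym2 (Fin n)) :=
  (embVerts σ, embEdges F σ)

/-- The vertices of `F` that `σ` maps into `W`. -/
noncomputable def sharedVerts (σ : Fin k ↪ Fin n) (W : Finset (Fin n)) : Finset (Fin k) :=
  Finset.univ.filter (σ · ∈ W)

/-- The edges of `F` that `σ` maps into `U`. -/
noncomputable def sharedEdges (σ : Fin k ↪ Fin n) (U : Finset (Sym2 (Fin n))) :
    Finset (Sym2 (Fin k)) :=
  F.edgeFinset.filter (σ.sym2Map · ∈ U)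

lemma mem_embVerts {σ : Fin k ↪ Fin n} {a : Fin n} : a ∈ embVerts σ ↔ ∃ v, σ v = a := by
  simp [embVerts]

lemma mem_embEdges {σ : Fin k ↪ Fin n} {e : Sym2 (Fin n)} :
    e ∈ embEdges F σ ↔ ∃ f ∈ F.edgeSet, Sym2.map σ f = e := by
  simp [embEdges]

lemma card_embVerts (σ : Fin k ↪ Fin n) : (embVerts σ).card = k := by
  simp [embVerts]

lemma card_embEdges (σ : Fin k ↪ Fin n) : (embEdges F σ).card = F.edgeFinset.card := by
  simp only [embEdges, Finset.card_map]

lemma mem_embVerts_of_mem_embEdges {σ : Fin k ↪ Fin n} {e : Sym2 (Fin n)} (he : e ∈ embEdges F σ)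
    {v : Fin n} (hv : v ∈ e) : v ∈ embVerts σ := by
  obtain ⟨f, -, rfl⟩ := (mem_embEdges F).1 he
  obtain ⟨w, -, rfl⟩ := Sym2.mem_map.1 hv
  exact mem_embVerts.2 ⟨w, rfl⟩

lemma embEdges_subset_edgeFinset_top (σ : Fin k ↪ Fin n) :
    embEdges F σ ⊆ (⊤ : SimpleGraph (Fin n)).edgeFinset := by
  intro e he
  obtain ⟨f, hf, rfl⟩ := (mem_embEdges F).1 he
  induction f with
  | h a b =>
    have hab := SimpleGraph.Adj.ne hf
    simpa using hab

lemma disjoint_embEdges {σ τ : Fin k ↪ Fin n} (h : Disjoint (embVerts σ) (embVerts τ)) :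
    Disjoint (embEdges F σ) (embEdges F τ) := by
  rw [Finset.disjoint_left] at h ⊢
  intro e h1 h2
  induction e with
  | h a b =>
    exact h (mem_embVerts_of_mem_embEdges F h1 (Sym2.mem_mk_left a b))
      (mem_embVerts_of_mem_embEdges F h2 (Sym2.mem_mk_left a b))

/-- Every copy of `F` arises from exactly `aut F` embeddings. -/
lemma card_filter_embCopy_eq (σ : Fin k ↪ Fin n) :
    (Finset.univ.filter fun τ => embCopy F τ = embCopy F σ).card = Nat.card (F ≃g F) := by
  have : Finite (F ≃g F) := DFunLike.finite _
  have : Fintype (F ≃g F) := Fintype.ofFinite _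
  rw [Nat.card_eq_fintype_card, ← Finset.card_univ]
  symm
  refine Finset.card_bij (fun g _ => g.toEquiv.toEmbedding.trans σ) ?_ ?_ ?_
  · intro g _
    rw [Finset.mem_filter]
    refine ⟨Finset.mem_univ _, Prod.ext ?_ ?_⟩
    · ext a
      simp only [embCopy, mem_embVerts]
      constructor
      · rintro ⟨v, rfl⟩; exact ⟨g v, rfl⟩
      · rintro ⟨v, rfl⟩; exact ⟨g.symm v, by simp⟩
    · ext e
      simp only [embCopy, mem_embEdges]
      constructor
      · rintro ⟨f, hf, rfl⟩
        refine ⟨Sym2.map g f, ?_, ?_⟩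
        · induction f with
          | h a b => exact g.map_adj_iff.2 hf
        · induction f with
          | h a b => rfl
      · rintro ⟨f, hf, rfl⟩
        refine ⟨Sym2.map g.symm f, ?_, ?_⟩
        · induction f with
          | h a b => exact g.symm.map_adj_iff.2 hf
        · induction f with
          | h a b => simp
  · intro g _ g' _ h
    ext v
    have := DFunLike.congr_fun h v
    exact congrArg _ (σ.injective this)
  · intro τ hτ
    have hc := (Finset.mem_filter.1 hτ).2
    have hV : embVerts τ = embVerts σ := congrArg Prod.fst hc
    have hE : embEdges F τ = embEdges F σ := congrArg Prod.snd hc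
    have hex (v : Fin k) : ∃ w, σ w = τ v :=
      mem_embVerts.1 (hV ▸ mem_embVerts.2 ⟨v, rfl⟩)
    choose g hg using hex
    have ginj : Function.Injective g := fun v w h => τ.injective (by rw [← hg, ← hg, h])
    have adj_iff (ρ : Fin k ↪ Fin n) (a b : Fin k) : s(ρ a, ρ b) ∈ embEdges F ρ ↔ F.Adj a b := by
      have : s(ρ a, ρ b) = ρ.sym2Map s(a, b) := rfl
      rw [this, embEdges, Finset.mem_map']
      simp
    refine ⟨⟨Equiv.ofBijective g (Finite.injective_iff_bijective.1 ginj), ?_⟩,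
      Finset.mem_univ _, ?_⟩
    · intro a b
      change F.Adj (g a) (g b) ↔ _
      rw [← adj_iff σ, hg, hg, ← hE, adj_iff]
    · ext v
      exact congrArg _ (hg v)

lemma StrictlyBalancedSG.mul_card_lt {F : SimpleGraph (Fin k)} (hbal : StrictlyBalancedSG F)
    {p : Finset (Fin k) × Finset (Sym2 (Fin k))} (hp : IsSubgraphPair F p) (hne : p.1.Nonempty)
    (hnot : ¬(p.1 = Finset.univ ∧ p.2 = F.edgeFinset)) :
    k * p.2.card < F.edgeFinset.card * p.1.card := by
  have h := hbal p hp hne (fun ⟨h1, h2⟩ => hnot ⟨by exact_mod_cast h1, by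
    ext e; rw [SimpleGraph.mem_edgeFinset, ← h2, Finset.mem_coe]⟩)
  have hk : 0 < k := by
    obtain ⟨v, _⟩ := hne
    exact v.pos
  have hl : F.edgeSet.ncard = F.edgeFinset.card := by
    rw [← SimpleGraph.coe_edgeFinset, Set.ncard_coe_finset]
  rw [hl, div_lt_div_iff₀ (by exact_mod_cast hne.card_pos) (by exact_mod_cast hk)] at h
  rw [mul_comm k]
  exact_mod_cast h

lemma StrictlyBalancedSG.mul_card_le {F : SimpleGraph (Fin k)} (hbal : StrictlyBalancedSG F)
    {p : Finset (Fin k) × Finset (Sym2 (Fin k))} (hp : IsSubgraphPair F p) :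
    k * p.2.card ≤ F.edgeFinset.card * p.1.card := by
  rcases p.1.eq_empty_or_nonempty with h0 | hne
  · have : p.2 = ∅ := by
      rw [Finset.eq_empty_iff_forall_notMem]
      intro e he
      induction e with
      | h a b => simpa [h0] using hp.2 _ he a (Sym2.mem_mk_left a b)
    simp [this]
  · by_cases hnot : p.1 = Finset.univ ∧ p.2 = F.edgeFinset
    · rw [hnot.1, hnot.2, Finset.card_univ, Fintype.card_fin, mul_comm]
    · exact (hbal.mul_card_lt hp hne hnot).le

lemma isSubgraphPair_shared (σ : Fin k ↪ Fin n) {W : Finset (Fin n)} {U : Finset (Sym2 (Fin n))}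
    (hUW : ∀ e ∈ U, ∀ v ∈ e, v ∈ W) :
    IsSubgraphPair F (sharedVerts σ W, sharedEdges F σ U) := by
  constructor
  · intro e he
    exact SimpleGraph.mem_edgeFinset.1 (Finset.mem_filter.1 he).1
  · intro e he v hv
    exact Finset.mem_filter.2 ⟨Finset.mem_univ _,
      hUW _ (Finset.mem_filter.1 he).2 _ (Sym2.mem_map.2 ⟨v, hv, rfl⟩)⟩

lemma card_union_embEdges (σ : Fin k ↪ Fin n) (U : Finset (Sym2 (Fin n))) :
    (U ∪ embEdges F σ).card = U.card + (F.edgeFinset.card - (sharedEdges F σ U).card) := by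
  have h : U ∪ embEdges F σ = U ∪ (F.edgeFinset.filter (σ.sym2Map · ∉ U)).map σ.sym2Map := by
    ext e
    simp only [embEdges, Finset.mem_union, Finset.mem_map, Finset.mem_filter]
    constructor
    · rintro (h | ⟨f, hf, rfl⟩)
      · exact Or.inl h
      · by_cases hU : σ.sym2Map f ∈ U
        · exact Or.inl hU
        · exact Or.inr ⟨f, ⟨hf, hU⟩, rfl⟩
    · rintro (h | ⟨f, ⟨hf, -⟩, rfl⟩)
      · exact Or.inl h
      · exact Or.inr ⟨f, hf, rfl⟩
  rw [h, Finset.card_union_of_disjoint, Finset.card_map]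
  · have := Finset.card_filter_add_card_filter_not (s := F.edgeFinset) (σ.sym2Map · ∈ U)
    unfold sharedEdges
    omega
  · rw [Finset.disjoint_right]
    simp only [Finset.mem_map, Finset.mem_filter]
    rintro _ ⟨f, ⟨-, hf⟩, rfl⟩
    exact hf

lemma sum_pow_mul_sub_card_sharedVerts_le {y : ℝ} (hy : 0 ≤ y) (W : Finset (Fin n))
    (s : Finset (Fin k ↪ Fin n)) :
    ∑ σ ∈ s, y ^ (k - (sharedVerts σ W).card) ≤ (W.card + n * y) ^ k := by
  have e (σ : Fin k ↪ Fin n) : y ^ (k - (sharedVerts σ W).card) =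
      ∏ v, if σ v ∈ W then 1 else y := by
    rw [Finset.prod_ite, Finset.prod_const_one, one_mul, Finset.prod_const]
    have := Finset.card_filter_add_card_filter_not (s := Finset.univ) (σ · ∈ W)
    rw [Finset.card_univ, Fintype.card_fin] at this
    congr 1
    unfold sharedVerts
    omega
  calc ∑ σ ∈ s, y ^ (k - (sharedVerts σ W).card)
      ≤ ∑ σ : Fin k ↪ Fin n, ∏ v, (if σ v ∈ W then 1 else y) := by
        simp only [e]
        refine Finset.sum_le_sum_of_subset_of_nonneg (Finset.subset_univ _) fun σ _ _ => ?_
        exact Finset.prod_nonneg fun v _ => by split_ifs <;> positivity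
    _ = ∑ f ∈ Finset.univ.map ⟨fun σ : Fin k ↪ Fin n => (σ : Fin k → Fin n),
          DFunLike.coe_injective⟩, ∏ v, (if f v ∈ W then 1 else y) := by
        rw [Finset.sum_map]; rfl
    _ ≤ ∑ f : Fin k → Fin n, ∏ v, (if f v ∈ W then 1 else y) := by
        refine Finset.sum_le_sum_of_subset_of_nonneg (Finset.subset_univ _) fun σ _ _ => ?_
        exact Finset.prod_nonneg fun v _ => by split_ifs <;> positivity
    _ = (∑ a : Fin n, if a ∈ W then 1 else y) ^ k := by
        rw [Finset.sum_pow', Fintype.piFinset_univ]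
    _ ≤ (W.card + n * y) ^ k := by
        have h0 : 0 ≤ ∑ a : Fin n, if a ∈ W then 1 else y :=
          Finset.sum_nonneg fun v _ => by split_ifs <;> positivity
        refine pow_le_pow_left₀ h0 ?_ k
        calc ∑ a : Fin n, (if a ∈ W then 1 else y)
            ≤ ∑ a : Fin n, ((if a ∈ W then 1 else 0) + y) := by
              refine Finset.sum_le_sum fun a _ => ?_
              split_ifs <;> linarith
          _ = W.card + n * y := by
              rw [Finset.sum_add_distrib]; simp

/-- The total weight of all extensions of `(W, U)` by a copy of `F` is controlled by the weight of
`U`, with an extra factor `x ^ t` if the intersections are sparse. -/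
lemma sum_inclProb_union_le {N m : ℕ} (hmN : m ≤ N) {x K : ℝ} (hx0 : 0 ≤ x) (hx1 : x ≤ 1)
    (hnx : n * x ^ F.edgeFinset.card = 1) (hK : 1 ≤ K) (hp : (m : ℝ) / N ≤ K * x ^ k)
    (W : Finset (Fin n)) (U : Finset (Sym2 (Fin n))) (s : Finset (Fin k ↪ Fin n)) (t : ℕ)
    (hs : ∀ σ ∈ s, k * (sharedEdges F σ U).card + t ≤
      F.edgeFinset.card * (sharedVerts σ W).card) :
    ∑ σ ∈ s, inclProb N m (U ∪ embEdges F σ).card ≤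
      K ^ F.edgeFinset.card * (W.card + 1) ^ k * x ^ t * inclProb N m U.card := by
  set l := F.edgeFinset.card
  have hpt (σ) (hσ : σ ∈ s) : inclProb N m (U ∪ embEdges F σ).card ≤
      inclProb N m U.card * K ^ l * x ^ t * (x ^ l) ^ (k - (sharedVerts σ W).card) := by
    set i := (sharedEdges F σ U).card
    set j := (sharedVerts σ W).card
    have hi : i ≤ l := Finset.card_filter_le _ _
    have hj : j ≤ k := (Finset.card_filter_le _ _).trans (by simp)
    have hij : k * i + t ≤ l * j := hs σ hσ
    rw [card_union_embEdges]
    have h1 : ((m : ℝ) / N) ^ (l - i) ≤ K ^ l * (x ^ t * (x ^ l) ^ (k - j)) := by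
      calc ((m : ℝ) / N) ^ (l - i) ≤ (K * x ^ k) ^ (l - i) := by gcongr
        _ = K ^ (l - i) * x ^ (k * (l - i)) := by rw [mul_pow, ← pow_mul]
        _ ≤ K ^ l * x ^ (t + l * (k - j)) := by
          refine mul_le_mul (pow_le_pow_right₀ hK (Nat.sub_le _ _))
            (pow_le_pow_of_le_one hx0 hx1 ?_) (by positivity) (by positivity)
          obtain ⟨a, ha⟩ := Nat.exists_eq_add_of_le hi
          obtain ⟨b, hb⟩ := Nat.exists_eq_add_of_le hj
          have e1 : l - i = a := by omega
          have e2 : k - j = b := by omega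
          rw [e1, e2]
          have e3 : k * l = k * i + k * a := by rw [ha]; ring
          have e4 : l * k = l * j + l * b := by rw [hb]; ring
          have e5 : k * l = l * k := mul_comm _ _
          omega
        _ = _ := by rw [pow_add, ← pow_mul]
    calc _ ≤ inclProb N m U.card * ((m : ℝ) / N) ^ (l - i) := inclProb_add_le hmN _ _
      _ ≤ inclProb N m U.card * (K ^ l * (x ^ t * (x ^ l) ^ (k - j))) :=
        mul_le_mul_of_nonneg_left h1 (inclProb_nonneg _ _ _)
      _ = _ := by ring
  refine (Finset.sum_le_sum hpt).trans ?_
  rw [← Finset.mul_sum]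
  have h := sum_pow_mul_sub_card_sharedVerts_le (y := x ^ l) (by positivity) W s
  rw [hnx] at h
  have h0 := inclProb_nonneg N m U.card
  calc _ ≤ inclProb N m U.card * K ^ l * x ^ t * (W.card + 1) ^ k := by gcongr
    _ = _ := by ring

/-- The union of the vertex sets of a tuple of embeddings. -/
noncomputable def tupleVerts {r : ℕ} (σ : Fin r → Fin k ↪ Fin n) : Finset (Fin n) :=
  Finset.univ.biUnion fun i => embVerts (σ i)

/-- The union of the edge sets of the copies given by a tuple of embeddings. -/
noncomputable def tupleEdges {r : ℕ} (σ : Fin r → Fin k ↪ Fin n) : Finset (Sym2 (Fin n)) :=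
  Finset.univ.biUnion fun i => embEdges F (σ i)

/-- The images of the embeddings of a tuple are pairwise disjoint. -/
def TupleDisjoint {r : ℕ} (σ : Fin r → Fin k ↪ Fin n) : Prop :=
  Pairwise fun i j => Disjoint (embVerts (σ i)) (embVerts (σ j))

lemma card_tupleVerts_le {r : ℕ} (σ : Fin r → Fin k ↪ Fin n) :
    (tupleVerts σ).card ≤ r * k := by
  refine Finset.card_biUnion_le.trans ?_
  simp [card_embVerts]

lemma mem_tupleVerts_of_mem_tupleEdges {r : ℕ} (σ : Fin r → Fin k ↪ Fin n) :
    ∀ e ∈ tupleEdges F σ, ∀ v ∈ e, v ∈ tupleVerts σ := by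
  intro e he v hv
  obtain ⟨i, hi, he⟩ := Finset.mem_biUnion.1 he
  exact Finset.mem_biUnion.2 ⟨i, hi, mem_embVerts_of_mem_embEdges F he hv⟩

lemma tupleEdges_cons {r : ℕ} (τ : Fin k ↪ Fin n) (σ : Fin r → Fin k ↪ Fin n) :
    tupleEdges F (Fin.cons τ σ : Fin (r + 1) → Fin k ↪ Fin n) = tupleEdges F σ ∪ embEdges F τ := by
  ext e
  simp [tupleEdges, Fin.exists_fin_succ, or_comm]

lemma card_tupleEdges {r : ℕ} {σ : Fin r → Fin k ↪ Fin n} (h : TupleDisjoint σ) :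
    (tupleEdges F σ).card = r * F.edgeFinset.card := by
  unfold tupleEdges
  rw [Finset.card_biUnion fun i _ j _ hij => disjoint_embEdges F (h hij)]
  simp only [card_embEdges, Finset.sum_const, Finset.card_univ, Fintype.card_fin, smul_eq_mul]

lemma tupleDisjoint_cons {r : ℕ} {τ : Fin k ↪ Fin n} {σ : Fin r → Fin k ↪ Fin n}
    (hσ : TupleDisjoint σ) (hτ : Disjoint (embVerts τ) (tupleVerts σ)) :
    TupleDisjoint (Fin.cons τ σ : Fin (r + 1) → Fin k ↪ Fin n) := by
  have h (i : Fin r) : Disjoint (embVerts τ) (embVerts (σ i)) :=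
    Finset.disjoint_of_subset_right (Finset.subset_biUnion_of_mem (fun i => embVerts (σ i))
      (Finset.mem_univ i)) hτ
  intro i j hij
  induction i using Fin.cases with
  | zero =>
    induction j using Fin.cases with
    | zero => exact absurd rfl hij
    | succ j => simpa using h j
  | succ i =>
    induction j using Fin.cases with
    | zero => simpa using (h i).symm
    | succ j => simpa using hσ (fun h => hij (congrArg _ h))

/-- A new copy of `F` meeting a disjoint union of copies does so in a subgraph which is sparser
than `F`. -/
lemma mul_card_sharedEdges_lt {F : SimpleGraph (Fin k)} (hbal : StrictlyBalancedSG F) {r : ℕ}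
    {τ : Fin k ↪ Fin n} {σ : Fin r → Fin k ↪ Fin n} (hσ : TupleDisjoint σ)
    (hτ : ¬Disjoint (embVerts τ) (tupleVerts σ)) (hne : ∀ i, embCopy F τ ≠ embCopy F (σ i)) :
    k * (sharedEdges F τ (tupleEdges F σ)).card + 1 ≤
      F.edgeFinset.card * (sharedVerts τ (tupleVerts σ)).card := by
  set V : Fin r → Finset (Fin k) := fun i => sharedVerts τ (embVerts (σ i))
  set E : Fin r → Finset (Sym2 (Fin k)) := fun i => sharedEdges F τ (embEdges F (σ i))
  have hV : sharedVerts τ (tupleVerts σ) = Finset.univ.biUnion V := by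
    ext v; simp [V, sharedVerts, tupleVerts]
  have hE : sharedEdges F τ (tupleEdges F σ) = Finset.univ.biUnion E := by
    ext v; simp [E, sharedEdges, tupleEdges]
  have hVd : ((Finset.univ : Finset (Fin r)) : Set (Fin r)).PairwiseDisjoint V := by
    intro i _ j _ hij
    refine Finset.disjoint_left.2 fun v h1 h2 => ?_
    exact Finset.disjoint_left.1 (hσ hij) (Finset.mem_filter.1 h1).2 (Finset.mem_filter.1 h2).2
  have hp (i : Fin r) : IsSubgraphPair F (V i, E i) :=
    isSubgraphPair_shared F τ fun e he v hv => mem_embVerts_of_mem_embEdges F he hv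
  have hlt (i : Fin r) (hi : (V i).Nonempty) :
      k * (E i).card < F.edgeFinset.card * (V i).card := by
    refine hbal.mul_card_lt (hp i) hi fun ⟨h1, h2⟩ => hne i ?_
    refine Prod.ext ?_ ?_
    · refine Finset.eq_of_subset_of_card_le ?_ (by simp [embCopy, card_embVerts])
      intro a ha
      obtain ⟨v, rfl⟩ := mem_embVerts.1 ha
      have : v ∈ V i := by rw [show V i = Finset.univ from h1]; exact Finset.mem_univ v
      exact (Finset.mem_filter.1 this).2
    · refine Finset.eq_of_subset_of_card_le ?_ (by simp only [embCopy, card_embEdges]; rfl)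
      intro e he
      obtain ⟨f, hf, rfl⟩ := Finset.mem_map.1 he
      have : f ∈ E i := by rw [show E i = F.edgeFinset from h2]; exact hf
      exact (Finset.mem_filter.1 this).2
  obtain ⟨a, ha, ha'⟩ := Finset.not_disjoint_iff.1 hτ
  obtain ⟨v, rfl⟩ := mem_embVerts.1 ha
  obtain ⟨i₀, -, hi₀⟩ := Finset.mem_biUnion.1 ha'
  rw [hV, hE, Finset.card_biUnion hVd, Finset.mul_sum, Nat.add_one_le_iff]
  calc k * (Finset.univ.biUnion E).card ≤ k * ∑ i, (E i).card :=
        Nat.mul_le_mul_left _ Finset.card_biUnion_le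
    _ = ∑ i, k * (E i).card := Finset.mul_sum _ _ _
    _ < ∑ i, F.edgeFinset.card * (V i).card :=
        Finset.sum_lt_sum (fun i _ => hbal.mul_card_le (hp i))
          ⟨i₀, Finset.mem_univ _, hlt i₀ ⟨v, Finset.mem_filter.2 ⟨Finset.mem_univ _, hi₀⟩⟩⟩

variable (n) in
/-- The weight of all tuples of vertex-disjoint embeddings. -/
noncomputable def disjointSum (N m r : ℕ) : ℝ :=
  ∑ σ : Fin r → Fin k ↪ Fin n with TupleDisjoint σ, inclProb N m (tupleEdges F σ).card

variable (n) in
/-- The weight of all tuples of embeddings which give distinct copies of `F` that are not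
vertex-disjoint. -/
noncomputable def overlapSum (N m r : ℕ) : ℝ :=
  ∑ σ : Fin r → Fin k ↪ Fin n with
    Function.Injective (fun i => embCopy F (σ i)) ∧ ¬TupleDisjoint σ,
    inclProb N m (tupleEdges F σ).card

lemma overlapSum_nonneg (N m r : ℕ) : 0 ≤ overlapSum n F N m r :=
  Finset.sum_nonneg fun _ _ => inclProb_nonneg _ _ _

lemma overlapSum_zero (N m : ℕ) : overlapSum n F N m 0 = 0 := by
  unfold overlapSum
  rw [Finset.filter_false_of_mem, Finset.sum_empty]
  exact fun σ _ h => h.2 fun i => i.elim0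

lemma overlapSum_succ_le {F : SimpleGraph (Fin k)} (hbal : StrictlyBalancedSG F) {N m : ℕ}
    (hmN : m ≤ N) {x K : ℝ} (hx0 : 0 ≤ x) (hx1 : x ≤ 1)
    (hnx : n * x ^ F.edgeFinset.card = 1) (hK : 1 ≤ K) (hp : (m : ℝ) / N ≤ K * x ^ k) (r : ℕ) :
    overlapSum n F N m (r + 1) ≤ K ^ F.edgeFinset.card * ((r * k : ℕ) + 1) ^ k *
      (overlapSum n F N m r + x * disjointSum n F N m r) := by
  set C : ℝ := K ^ F.edgeFinset.card * ((r * k : ℕ) + 1) ^ k with hC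
  have hext (σ : Fin r → Fin k ↪ Fin n) (s : Finset (Fin k ↪ Fin n)) (t : ℕ)
      (hs : ∀ τ ∈ s, k * (sharedEdges F τ (tupleEdges F σ)).card + t ≤
        F.edgeFinset.card * (sharedVerts τ (tupleVerts σ)).card) :
      ∑ τ ∈ s, inclProb N m (tupleEdges F σ ∪ embEdges F τ).card ≤
        C * x ^ t * inclProb N m (tupleEdges F σ).card := by
    refine (sum_inclProb_union_le F hmN hx0 hx1 hnx hK hp _ _ s t hs).trans ?_
    have h0 := inclProb_nonneg N m (tupleEdges F σ).card
    have h1 : ((tupleVerts σ).card : ℝ) ≤ (r * k : ℕ) := by exact_mod_cast card_tupleVerts_le σ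
    rw [hC]
    gcongr
  have hsplit : overlapSum n F N m (r + 1) =
      ∑ σ : Fin r → Fin k ↪ Fin n, ∑ τ : Fin k ↪ Fin n with
        (Function.Injective (fun i => embCopy F ((Fin.cons τ σ : Fin (r + 1) → Fin k ↪ Fin n) i)) ∧
          ¬TupleDisjoint (Fin.cons τ σ : Fin (r + 1) → Fin k ↪ Fin n)),
        inclProb N m (tupleEdges F σ ∪ embEdges F τ).card := by
    unfold overlapSum
    simp only [Finset.sum_filter]
    rw [← (Fin.consEquiv fun _ : Fin (r + 1) => Fin k ↪ Fin n).sum_comp, Fintype.sum_prod_type,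
      Finset.sum_comm]
    have e (τ : Fin k ↪ Fin n) (σ : Fin r → Fin k ↪ Fin n) :
        (Fin.consEquiv fun _ : Fin (r + 1) => Fin k ↪ Fin n) (τ, σ) = Fin.cons τ σ := rfl
    simp only [e, tupleEdges_cons]
  have hinj {τ : Fin k ↪ Fin n} {σ : Fin r → Fin k ↪ Fin n} (h : Function.Injective
      (fun i => embCopy F ((Fin.cons τ σ : Fin (r + 1) → Fin k ↪ Fin n) i))) :
      Function.Injective (fun i => embCopy F (σ i)) ∧ ∀ i, embCopy F τ ≠ embCopy F (σ i) := by
    constructor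
    · intro i j hij
      exact Fin.succ_injective _ (h (a₁ := i.succ) (a₂ := j.succ) (by simpa using hij))
    · intro i hi
      exact Fin.succ_ne_zero i (h (a₁ := i.succ) (a₂ := 0) (by simpa using hi.symm))
  rw [hsplit]
  unfold overlapSum disjointSum
  rw [Finset.mul_sum, mul_add, Finset.mul_sum, Finset.mul_sum, Finset.sum_filter,
    Finset.sum_filter, ← Finset.sum_add_distrib]
  refine Finset.sum_le_sum fun σ _ => ?_
  have hq := inclProb_nonneg N m (tupleEdges F σ).card
  have hC0 : 0 ≤ C := by positivity
  by_cases hd : TupleDisjoint σ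
  · rw [if_neg (fun h => h.2 hd), if_pos hd, zero_add]
    refine (hext σ _ 1 fun τ hτ => ?_).trans (by rw [pow_one, mul_assoc])
    obtain ⟨-, h1, h2⟩ := Finset.mem_filter.1 hτ
    exact mul_card_sharedEdges_lt hbal hd (fun h => h2 (tupleDisjoint_cons hd h)) (hinj h1).2
  · rw [if_neg hd, add_zero]
    by_cases hI : Function.Injective (fun i => embCopy F (σ i))
    · rw [if_pos ⟨hI, hd⟩]
      refine (hext σ _ 0 fun τ _ => ?_).trans (by rw [pow_zero, mul_one])
      exact hbal.mul_card_le
        (isSubgraphPair_shared F τ (mem_tupleVerts_of_mem_tupleEdges F σ))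
    · rw [if_neg (fun h => hI h.1), Finset.filter_false_of_mem fun τ _ h => hI (hinj h.1).1,
        Finset.sum_empty]

lemma card_filter_tupleDisjoint (r : ℕ) :
    (Finset.univ.filter fun σ : Fin r → Fin k ↪ Fin n => TupleDisjoint σ).card =
      n.descFactorial (r * k) := by
  have h : Fintype.card (Fin r × Fin k ↪ Fin n) = n.descFactorial (r * k) := by
    rw [Fintype.card_embedding_eq]; simp
  rw [← h, ← Finset.card_univ]
  symm
  refine Finset.card_bij (fun φ _ i => ⟨fun v => φ (i, v), fun v w hvw =>
    congrArg Prod.snd (φ.injective hvw)⟩) ?_ ?_ ?_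
  · intro φ _
    refine Finset.mem_filter.2 ⟨Finset.mem_univ _, fun i j hij => ?_⟩
    refine Finset.disjoint_left.2 fun a h1 h2 => ?_
    obtain ⟨v, rfl⟩ := mem_embVerts.1 h1
    obtain ⟨w, hw⟩ := mem_embVerts.1 h2
    exact hij (congrArg Prod.fst (φ.injective hw)).symm
  · intro φ _ ψ _ h
    ext ⟨i, v⟩
    exact congrArg Fin.val (DFunLike.congr_fun (congrFun h i) v)
  · intro σ hσ
    have hd := (Finset.mem_filter.1 hσ).2
    refine ⟨⟨fun p => σ p.1 p.2, ?_⟩, Finset.mem_univ _, rfl⟩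
    rintro ⟨i, v⟩ ⟨j, w⟩ hvw
    have hvw' : σ i v = σ j w := hvw
    by_cases hij : i = j
    · subst hij
      rw [(σ i).injective hvw']
    · exact absurd (mem_embVerts.2 ⟨w, hvw'.symm⟩)
        (Finset.disjoint_left.1 (hd hij) (mem_embVerts.2 ⟨v, rfl⟩))

lemma disjointSum_eq (N m r : ℕ) : disjointSum n F N m r =
    n.descFactorial (r * k) * inclProb N m (r * F.edgeFinset.card) := by
  unfold disjointSum
  rw [Finset.sum_congr rfl fun σ hσ => by rw [card_tupleEdges F (Finset.mem_filter.1 hσ).2],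
    Finset.sum_const, card_filter_tupleDisjoint, nsmul_eq_mul]

/-- The number of copies of `F` whose edges all lie in `H`. -/
noncomputable def copyCount (H : Finset (Sym2 (Fin n))) : ℕ :=
  ((Finset.univ.image (embCopy F)).filter fun p => p.2 ⊆ H).card

lemma descFactorial_copyCount_mul (H : Finset (Sym2 (Fin n))) (r : ℕ) :
    (copyCount F H).descFactorial r * Nat.card (F ≃g F) ^ r =
      (Finset.univ.filter fun σ : Fin r → Fin k ↪ Fin n =>
        Function.Injective (fun i => embCopy F (σ i)) ∧ tupleEdges F σ ⊆ H).card := by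
  set 𝒞 := (Finset.univ.image (embCopy (n := n) F)).filter fun p => p.2 ⊆ H with h𝒞
  have hmem (p) : p ∈ 𝒞 ↔ (∃ τ, embCopy F τ = p) ∧ p.2 ⊆ H := by simp [h𝒞]
  have hcard : (copyCount F H).descFactorial r = Fintype.card (Fin r ↪ 𝒞) := by
    rw [Fintype.card_embedding_eq, Fintype.card_fin, Fintype.card_coe]
    rfl
  rw [hcard, ← Finset.card_univ, ← smul_eq_mul, ← Finset.sum_const]
  have hsub {σ : Fin r → Fin k ↪ Fin n} : tupleEdges F σ ⊆ H ↔ ∀ i, embEdges F (σ i) ⊆ H := by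
    simp [tupleEdges]
  set S := Finset.univ.filter fun σ : Fin r → Fin k ↪ Fin n =>
        Function.Injective (fun i => embCopy F (σ i)) ∧ tupleEdges F σ ⊆ H with hS
  have hin (σ) (hσ : σ ∈ S) (i : Fin r) : embCopy F (σ i) ∈ 𝒞 :=
    (hmem _).2 ⟨⟨σ i, rfl⟩, hsub.1 (Finset.mem_filter.1 hσ).2.2 i⟩
  set f : (Fin r → Fin k ↪ Fin n) → (Fin r → Finset (Fin n) × Finset (Sym2 (Fin n))) :=
    fun σ i => embCopy F (σ i) with hf
  set T := Finset.univ.image (fun (φ : Fin r ↪ 𝒞) i => ((φ i : 𝒞) :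
    Finset (Fin n) × Finset (Sym2 (Fin n)))) with hT
  have hinjT : Function.Injective (fun (φ : Fin r ↪ 𝒞) i => ((φ i : 𝒞) :
    Finset (Fin n) × Finset (Sym2 (Fin n)))) := by
    intro φ ψ h
    ext1 i
    exact Subtype.ext (congrFun h i)
  have hmaps : ∀ σ ∈ S, f σ ∈ T := by
    intro σ hσ
    refine Finset.mem_image.2
      ⟨⟨fun i => ⟨_, hin σ hσ i⟩, fun i j hij => ?_⟩, Finset.mem_univ _, rfl⟩
    exact (Finset.mem_filter.1 hσ).2.1 (congrArg Subtype.val hij)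
  rw [Finset.card_eq_sum_card_fiberwise hmaps, hT, Finset.sum_image fun _ _ _ _ h => hinjT h]
  refine Finset.sum_congr rfl fun φ _ => ?_
  have hfib : (S.filter fun σ => f σ = fun i => ((φ i : 𝒞) :
      Finset (Fin n) × Finset (Sym2 (Fin n)))) =
      Fintype.piFinset fun i => Finset.univ.filter fun τ => embCopy F τ = (φ i : 𝒞) := by
    ext σ
    simp only [Finset.mem_filter, Fintype.mem_piFinset, Finset.mem_univ, true_and, hS, hf,
      funext_iff]
    refine ⟨fun h => h.2, fun h => ⟨⟨?_, hsub.2 fun i => ?_⟩, h⟩⟩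
    · intro i j hij
      exact φ.injective (Subtype.ext ((h i).symm.trans (hij.trans (h j))))
    · have := ((hmem _).1 (φ i).2).2
      rw [← h i] at this
      exact this
  rw [hfib, Fintype.card_piFinset]
  rw [Finset.prod_congr rfl (g := fun _ => Nat.card (F ≃g F))]
  · simp
  · intro i _
    obtain ⟨τ, hτ⟩ := ((hmem _).1 (φ i).2).1
    rw [← hτ, card_filter_embCopy_eq]

lemma TupleDisjoint.injective_embCopy (hk : 0 < k) {r : ℕ} {σ : Fin r → Fin k ↪ Fin n}
    (h : TupleDisjoint σ) : Function.Injective (fun i => embCopy F (σ i)) := by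
  intro i j hij
  by_contra hne
  have hd : Disjoint (embVerts (σ i)) (embVerts (σ j)) := h hne
  rw [show embVerts (σ i) = embVerts (σ j) from congrArg Prod.fst hij, disjoint_self,
    Finset.bot_eq_empty, ← Finset.card_eq_zero, card_embVerts] at hd
  omega

/-- The factorial moments of the number of copies of `F` in a random graph with `m` edges. -/
lemma sum_descFactorial_copyCount (hk : 0 < k) (m r : ℕ) :
    (∑ H ∈ ((⊤ : SimpleGraph (Fin n)).edgeFinset).powersetCard m,
        ((copyCount F H).descFactorial r : ℝ)) * (Nat.card (F ≃g F) : ℝ) ^ r =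
      ((n.choose 2).choose m : ℝ) *
        (disjointSum n F (n.choose 2) m r + overlapSum n F (n.choose 2) m r) := by
  set T := (⊤ : SimpleGraph (Fin n)).edgeFinset with hT
  have hTc : T.card = n.choose 2 := by
    rw [hT, SimpleGraph.card_edgeFinset_top_eq_card_choose_two, Fintype.card_fin]
  have hsum : disjointSum n F (n.choose 2) m r + overlapSum n F (n.choose 2) m r =
      ∑ σ : Fin r → Fin k ↪ Fin n with Function.Injective (fun i => embCopy F (σ i)),
        inclProb (n.choose 2) m (tupleEdges F σ).card := by
    unfold disjointSum overlapSum
    symm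
    rw [← Finset.sum_filter_add_sum_filter_not _ TupleDisjoint, Finset.filter_filter,
      Finset.filter_filter]
    congr 1
    refine Finset.sum_congr (Finset.ext fun σ => ?_) fun _ _ => rfl
    simp only [Finset.mem_filter, Finset.mem_univ, true_and]
    exact ⟨fun h => h.2, fun h => ⟨h.injective_embCopy F hk, h⟩⟩
  rw [hsum, Finset.mul_sum, Finset.sum_mul]
  have hH (H : Finset (Sym2 (Fin n))) : ((copyCount F H).descFactorial r : ℝ) *
      (Nat.card (F ≃g F) : ℝ) ^ r = ∑ σ : Fin r → Fin k ↪ Fin n with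
        Function.Injective (fun i => embCopy F (σ i)), if tupleEdges F σ ⊆ H then 1 else 0 := by
    rw [Finset.sum_boole, Finset.filter_filter, ← descFactorial_copyCount_mul]
    push_cast
    rfl
  simp only [hH]
  rw [Finset.sum_comm]
  refine Finset.sum_congr rfl fun σ _ => ?_
  rw [Finset.sum_boole, card_filter_superset_eq, hTc]
  exact Finset.biUnion_subset.2 fun i _ => embEdges_subset_edgeFinset_top F _

end Embeddings

lemma countSubSG_eq_copyCount {k n : ℕ} (F : SimpleGraph (Fin k)) (G : SimpleGraph (Fin n)) :
    countSubSG F G = copyCount F G.edgeFinset := by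
  unfold countSubSG copyCount
  rw [← Set.ncard_coe_finset]
  congr 1
  ext p
  simp only [Set.mem_ofPred_eq, Finset.coe_filter, Finset.mem_image, Finset.mem_univ, true_and]
  have hiso : SubgraphIso F p ↔ ∃ σ, embCopy F σ = p := by
    refine exists_congr fun σ => ?_
    rw [embCopy, Prod.ext_iff, ← Finset.coe_inj, ← Finset.coe_inj]
    simp [embVerts, embEdges, eq_comm]
  rw [hiso, and_comm]
  refine and_congr_right fun ⟨σ, hσ⟩ => ?_
  subst hσ
  constructor
  · exact fun h e he => SimpleGraph.mem_edgeFinset.2 (h.1 e he)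
  · exact fun h => ⟨fun e he => SimpleGraph.mem_edgeFinset.1 (h he),
      fun e he v hv => mem_embVerts_of_mem_embEdges F he hv⟩

lemma ncard_free_eq {k : ℕ} (F : SimpleGraph (Fin k)) (n m : ℕ) :
    Set.ncard {G : SimpleGraph (Fin n) | G.edgeSet.ncard = m ∧ countSubSG F G = 0} =
      ((((⊤ : SimpleGraph (Fin n)).edgeFinset).powersetCard m).filter
        (copyCount F · = 0)).card := by
  have hcard (G : SimpleGraph (Fin n)) : G.edgeSet.ncard = G.edgeFinset.card := by
    rw [← SimpleGraph.coe_edgeFinset, Set.ncard_coe_finset]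
  rw [← Set.ncard_coe_finset]
  refine Set.ncard_congr (fun G _ => G.edgeFinset) ?_ ?_ ?_
  · rintro G ⟨h1, h2⟩
    rw [hcard] at h1
    rw [countSubSG_eq_copyCount] at h2
    exact Finset.mem_coe.2 (Finset.mem_filter.2 ⟨Finset.mem_powersetCard.2
      ⟨SimpleGraph.edgeFinset_mono le_top, h1⟩, h2⟩)
  · intro G G' _ _ h
    exact SimpleGraph.edgeFinset_inj.1 h
  · intro H hH
    obtain ⟨h1, h2⟩ := Finset.mem_filter.1 (Finset.mem_coe.1 hH)
    obtain ⟨h3, h4⟩ := Finset.mem_powersetCard.1 h1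
    obtain ⟨G, hG⟩ : ∃ G : SimpleGraph (Fin n), G.edgeSet = H := by
      refine ⟨SimpleGraph.fromEdgeSet H, ?_⟩
      rw [SimpleGraph.edgeSet_fromEdgeSet, sdiff_eq_left, Set.disjoint_left]
      exact fun e he => SimpleGraph.not_isDiag_of_mem_edgeFinset (h3 he)
    have he : G.edgeFinset = H := by
      rw [← Finset.coe_inj, SimpleGraph.coe_edgeFinset, hG]
    refine ⟨G, ⟨?_, ?_⟩, he⟩
    · rw [hcard, he, h4]
    · rw [countSubSG_eq_copyCount, he, h2]

lemma tendsto_disjointSum {k : ℕ} (F : SimpleGraph (Fin k)) {m : ℕ → ℕ}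
    (hminf : Tendsto m atTop atTop) (hmle : ∀ n, m n ≤ n.choose 2) {a : ℝ}
    (ha : Tendsto (fun n : ℕ => (n : ℝ) ^ k * ((m n : ℝ) / n.choose 2) ^ F.edgeFinset.card)
      atTop (nhds a)) (r : ℕ) :
    Tendsto (fun n => disjointSum n F (n.choose 2) (m n) r) atTop (nhds (a ^ r)) := by
  set l := F.edgeFinset.card
  have hN : Tendsto (fun n : ℕ => n.choose 2) atTop atTop := tendsto_atTop_mono hmle hminf
  have h : (fun n : ℕ => disjointSum n F (n.choose 2) (m n) r) ~[atTop]
      fun n : ℕ => ((n : ℝ) ^ (r * k)) * ((m n : ℝ) ^ (r * l) / (n.choose 2 : ℝ) ^ (r * l)) := by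
    simp only [disjointSum_eq, inclProb]
    exact (isEquivalent_descFactorial (r * k)).mul
      (((isEquivalent_descFactorial (r * l)).comp_tendsto hminf).div
        ((isEquivalent_descFactorial (r * l)).comp_tendsto hN))
  refine (h.tendsto_nhds_iff).2 ((ha.pow r).congr fun n => ?_)
  rw [mul_pow, ← pow_mul, ← pow_mul, div_pow, mul_comm k, mul_comm l]

lemma tendsto_overlapSum {k : ℕ} {F : SimpleGraph (Fin k)} (hbal : StrictlyBalancedSG F)
    {m : ℕ → ℕ} (hminf : Tendsto m atTop atTop) (hmle : ∀ n, m n ≤ n.choose 2) {a : ℝ}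
    (ha : Tendsto (fun n : ℕ => (n : ℝ) ^ k * ((m n : ℝ) / n.choose 2) ^ F.edgeFinset.card)
      atTop (nhds a)) {x : ℕ → ℝ} {K : ℝ} (hK : 1 ≤ K) (hx : Tendsto x atTop (nhds 0))
    (hx0 : ∀ᶠ n in atTop, 0 ≤ x n) (hnx : ∀ᶠ n : ℕ in atTop, n * x n ^ F.edgeFinset.card = 1)
    (hp : ∀ᶠ n : ℕ in atTop, (m n : ℝ) / n.choose 2 ≤ K * x n ^ k) (r : ℕ) :
    Tendsto (fun n => overlapSum n F (n.choose 2) (m n) r) atTop (nhds 0) := by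
  induction r with
  | zero => simp only [overlapSum_zero, tendsto_const_nhds]
  | succ r ih =>
    have hlim := (ih.add (hx.mul (tendsto_disjointSum F hminf hmle ha r))).const_mul
      (K ^ F.edgeFinset.card * (((r * k : ℕ) : ℝ) + 1) ^ k)
    rw [zero_mul, add_zero, mul_zero] at hlim
    refine tendsto_of_tendsto_of_tendsto_of_le_of_le' tendsto_const_nhds hlim
      (Eventually.of_forall fun n => overlapSum_nonneg F _ _ _) ?_
    filter_upwards [hx0, hnx, hp, hx.eventually (ge_mem_nhds one_pos)] with n h0 h1 h2 h3
    exact overlapSum_succ_le hbal (hmle n) h0 h3 h1 hK h2 r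

/-- the number of F-free (n, m(n))-graphs, for a strictly balanced F
at the threshold m(n) ~ c n^(2 − 1/d), is asymptotically
e^(−λ) · choose(choose(n,2), m(n)), with λ = (2c)^l / aut(F). -/
theorem stmt12 {k : ℕ} (F : SimpleGraph (Fin k)) (l : ℕ) (hl : l = F.edgeSet.ncard)
    (hl1 : 1 ≤ l) (hbal : StrictlyBalancedSG F)
    (d : ℝ) (hd : d = (l : ℝ) / k)
    (autF : ℕ) (haut : autF = Nat.card (F ≃g F))
    (c : ℝ) (hc : 0 < c)
    (m : ℕ → ℕ) (hminf : Tendsto m atTop atTop) (hmle : ∀ n, m n ≤ n.choose 2)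
    (hm : Tendsto (fun n : ℕ => (m n : ℝ) / (n : ℝ) ^ ((2 : ℝ) - 1 / d)) atTop (nhds c))
    (lam : ℝ) (hlam : lam = (2 * c) ^ l / autF) :
    Tendsto (fun n : ℕ =>
        (Set.ncard {G : SimpleGraph (Fin n) |
            G.edgeSet.ncard = m n ∧ countSubSG F G = 0} : ℝ) /
          ((n.choose 2).choose (m n) : ℝ)) atTop (nhds (Real.exp (-lam))) := by
  have hlE : F.edgeFinset.card = l := by
    rw [hl, ← SimpleGraph.coe_edgeFinset, Set.ncard_coe_finset]
  have hk : 0 < k := by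
    obtain ⟨e, -⟩ := Finset.card_pos.1 (hlE ▸ hl1 : 0 < F.edgeFinset.card)
    induction e with
    | h a b => exact a.pos
  have hl0 : (0 : ℝ) < l := by exact_mod_cast hl1
  have hk0 : (0 : ℝ) < k := by exact_mod_cast hk
  set x : ℕ → ℝ := fun n => (n : ℝ) ^ (-(1 / (l : ℝ))) with hxdef
  have hx : Tendsto x atTop (nhds 0) :=
    (tendsto_rpow_neg_atTop (by positivity)).comp tendsto_natCast_atTop_atTop
  have hxpos (n : ℕ) (hn : 1 ≤ n) : 0 < x n := Real.rpow_pos_of_pos (by exact_mod_cast hn) _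
  have hnx (n : ℕ) (hn : 1 ≤ n) : n * x n ^ l = 1 := by
    have hn0 : (0 : ℝ) < n := by exact_mod_cast hn
    rw [hxdef, ← Real.rpow_mul_natCast hn0.le, neg_mul, one_div_mul_cancel hl0.ne',
      Real.rpow_neg_one, mul_inv_cancel₀ hn0.ne']
  have hratio : Tendsto (fun n : ℕ => ((m n : ℝ) / n.choose 2) / x n ^ k) atTop
      (nhds (2 * c)) := by
    have h2 : Tendsto (fun n : ℕ => (n : ℝ) ^ 2 / n.choose 2) atTop (nhds 2) := by
      have h := (isEquivalent_choose 2).symm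
      have hpos : ∀ᶠ n : ℕ in atTop, (n.choose 2 : ℝ) ≠ 0 := by
        filter_upwards [eventually_ge_atTop 2] with n hn
        exact_mod_cast (Nat.choose_pos hn).ne'
      have h' := ((isEquivalent_iff_tendsto_one hpos).1 h).const_mul 2
      rw [mul_one] at h'
      refine h'.congr fun n => ?_
      simp only [Pi.div_apply, Nat.factorial_two]
      push_cast
      ring
    rw [mul_comm]
    refine (hm.mul h2).congr' ?_
    filter_upwards [eventually_ge_atTop 2] with n hn
    have hn0 : (0 : ℝ) < n := by exact_mod_cast (by omega : 0 < n)
    have hN0 : (n.choose 2 : ℝ) ≠ 0 := by exact_mod_cast (Nat.choose_pos hn).ne'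
    have hx0 := (hxpos n (by omega)).ne'
    have e : (n : ℝ) ^ ((2 : ℝ) - 1 / d) = (n : ℝ) ^ 2 * x n ^ k := by
      rw [hxdef, ← Real.rpow_mul_natCast hn0.le, ← Real.rpow_natCast (n : ℝ) 2,
        ← Real.rpow_add hn0, hd]
      congr 1
      push_cast
      field_simp
      ring
    rw [e]
    field_simp
  have ha : Tendsto (fun n : ℕ => (n : ℝ) ^ k * ((m n : ℝ) / n.choose 2) ^ F.edgeFinset.card)
      atTop (nhds ((2 * c) ^ l)) := by
    rw [hlE]
    refine (hratio.pow l).congr' ?_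
    filter_upwards [eventually_ge_atTop 1] with n hn
    have hx0 := (hxpos n hn).ne'
    have e : (n : ℝ) ^ k * (x n ^ k) ^ l = 1 := by
      rw [← pow_mul, mul_comm k l, pow_mul, ← mul_pow, hnx n hn, one_pow]
    rw [div_pow, div_eq_iff (by positivity)]
    linear_combination (-((m n : ℝ) / n.choose 2) ^ l) * e
  have hover := tendsto_overlapSum hbal hminf hmle ha (x := x) (K := 2 * c + 1) (by linarith) hx
    (eventually_atTop.2 ⟨1, fun n hn => (hxpos n hn).le⟩)
    (eventually_atTop.2 ⟨1, fun n hn => hlE ▸ hnx n hn⟩) (by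
      filter_upwards [hratio.eventually (ge_mem_nhds (lt_add_one (2 * c))),
        eventually_ge_atTop 1] with n h1 hn
      have hx0 := hxpos n hn
      rwa [div_le_iff₀ (by positivity)] at h1)
  have hΩ (n : ℕ) : (((⊤ : SimpleGraph (Fin n)).edgeFinset).powersetCard (m n)).card =
      (n.choose 2).choose (m n) := by
    rw [Finset.card_powersetCard, SimpleGraph.card_edgeFinset_top_eq_card_choose_two,
      Fintype.card_fin]
  have haut0 : (autF : ℝ) ≠ 0 := by
    have : Finite (F ≃g F) := DFunLike.finite _
    have : Nonempty (F ≃g F) := ⟨RelIso.refl _⟩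
    rw [haut]
    exact_mod_cast Nat.card_pos.ne'
  have hmain := tendsto_card_filter_eq_zero_div
    (fun n => ((⊤ : SimpleGraph (Fin n)).edgeFinset).powersetCard (m n))
    (fun _ => copyCount F) lam (fun r => by
      have h := ((tendsto_disjointSum F hminf hmle ha r).add (hover r)).div_const ((autF : ℝ) ^ r)
      rw [add_zero, ← div_pow, ← hlam] at h
      refine h.congr fun n => ?_
      have hs := sum_descFactorial_copyCount (n := n) F hk (m n) r
      have hC : ((n.choose 2).choose (m n) : ℝ) ≠ 0 := by
        exact_mod_cast (Nat.choose_pos (hmle n)).ne'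
      rw [← haut] at hs
      rw [hΩ, div_eq_div_iff (pow_ne_zero _ haut0) hC, hs, mul_comm])
  simpa only [ncard_free_eq, hΩ] using hmain
end

section
/- Let δ : ℕ → ℝ≥0 have finite support with at least two elements, let Δ(x) = Σ_d δ(d) x^d / d! (a real polynomial), and assume aperiodicity: the gcd of the set {d1 − d2 : d1 > d2, δ(d1) > 0, δ(d2) > 0} equals 1. Let m = m(n) be a sequence of integers with 2m(n)/n → γ where min Support(δ) < γ < max Support(δ), and assume MG(n, m(n), δ) > 0 for all sufficiently large n. Let G be a random (n, m(n), δ)-multigraph. Then for every connected multigraph H with m(H) ≥ n(H) + 1 (i.e. H is neither a tree nor a unicycle), P(G[H] > 0) → 0 as n → ∞; that is, asymptotically almost surely H is not a sub-multigraph of G. -/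
open scoped Classical
open Filter Asymptotics

/-- Any two embeddings of a type into a finite type differ by a permutation of the target. -/
lemma exists_perm_comp_embedding {α ι : Type*} [Finite α] (g h : ι ↪ α) :
    ∃ π : Equiv.Perm α, ∀ i, π (g i) = h i := by
  let e : {x // x ∈ Set.range g} ≃ {x // x ∈ Set.range h} :=
    (Equiv.ofInjective g g.injective).symm.trans (Equiv.ofInjective h h.injective)
  refine ⟨e.extendSubtype, fun i => ?_⟩
  rw [Equiv.extendSubtype_apply_of_mem e (g i) ⟨i, rfl⟩]
  have hi : (⟨g i, ⟨i, rfl⟩⟩ : {x // x ∈ Set.range g}) = Equiv.ofInjective g g.injective i := rfl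
  rw [hi]
  simp [e]

/-- If every fibre of `f` has at most `D` elements, at most `D ^ |ι|` embeddings `g` satisfy
`f ∘ g = t`. -/
lemma card_embedding_comp_eq_le {α β ι : Type*} [Fintype α] [DecidableEq β]
    [Fintype ι] (D : ℕ)
    (f : α → β) (hf : ∀ b, (Finset.univ.filter fun a => f a = b).card ≤ D) (t : ι → β) :
    (Finset.univ.filter fun g : ι ↪ α => ∀ i, f (g i) = t i).card ≤ D ^ Fintype.card ι := by
  calc (Finset.univ.filter fun g : ι ↪ α => ∀ i, f (g i) = t i).card
      ≤ (Fintype.piFinset fun i => Finset.univ.filter fun a => f a = t i).card := by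
        refine Finset.card_le_card_of_injOn (fun g => (g : ι → α)) ?_
          (DFunLike.coe_injective.injOn)
        intro g hg
        simpa using hg
    _ = ∏ i, (Finset.univ.filter fun a => f a = t i).card := Fintype.card_piFinset _
    _ ≤ ∏ _i : ι, D := Finset.prod_le_prod' fun i _ => hf _
    _ = D ^ Fintype.card ι := by simp

/-- For a permutation-invariant weight on functions, supported on functions whose fibres have at
most `D` elements, prescribing the values along an embedding costs a factor
`D ^ |ι| / (|α|)_{|ι|}`. -/
lemma descFactorial_mul_sum_le {α β ι : Type*} [Fintype α] [DecidableEq α] [Fintype β]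
    [DecidableEq β] [Fintype ι]
    (w : (α → β) → ℝ) (hw : ∀ f, 0 ≤ w f)
    (hinv : ∀ (π : Equiv.Perm α) f, w (f ∘ π) = w f) (D : ℕ)
    (hD : ∀ f, w f ≠ 0 → ∀ b, (Finset.univ.filter fun a => f a = b).card ≤ D)
    (h : ι ↪ α) (t : ι → β) :
    ((Fintype.card α).descFactorial (Fintype.card ι) : ℝ) *
        (∑ f : α → β, if ∀ i, f (h i) = t i then w f else 0)
      ≤ (D : ℝ) ^ Fintype.card ι * ∑ f : α → β, w f := by
  have hsymm : ∀ g : ι ↪ α, (∑ f : α → β, if ∀ i, f (g i) = t i then w f else 0)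
      = ∑ f : α → β, if ∀ i, f (h i) = t i then w f else 0 := by
    intro g
    obtain ⟨π, hπ⟩ := exists_perm_comp_embedding g h
    symm
    refine Fintype.sum_equiv (π.symm.arrowCongr (Equiv.refl β)) _ _ fun f => ?_
    have hf : (π.symm.arrowCongr (Equiv.refl β)) f = f ∘ π := rfl
    rw [hf, hinv]
    simp [hπ]
  have hcard : ((Fintype.card α).descFactorial (Fintype.card ι) : ℝ) *
      (∑ f : α → β, if ∀ i, f (h i) = t i then w f else 0)
      = ∑ g : ι ↪ α, ∑ f : α → β, if ∀ i, f (g i) = t i then w f else 0 := by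
    rw [Finset.sum_congr rfl fun g _ => hsymm g, Finset.sum_const, Finset.card_univ,
      Fintype.card_embedding_eq, nsmul_eq_mul]
  rw [hcard, Finset.sum_comm, Finset.mul_sum]
  refine Finset.sum_le_sum fun f _ => ?_
  rw [← Finset.sum_filter, Finset.sum_const, nsmul_eq_mul]
  by_cases h0 : w f = 0
  · simp [h0]
  · refine mul_le_mul_of_nonneg_right ?_ (hw f)
    exact_mod_cast card_embedding_comp_eq_le D f (hD f h0) t

/-- A multigraph as the assignment of an endpoint to each half-edge. -/
def halfEdgeEquiv (n m : ℕ) : (Fin m → Fin n × Fin n) ≃ (Fin m × Fin 2 → Fin n) where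
  toFun E ji := if ji.2 = 0 then (E ji.1).1 else (E ji.1).2
  invFun f j := (f (j, 0), f (j, 1))
  left_inv E := by ext j <;> simp
  right_inv f := by
    ext ⟨j, i⟩
    fin_cases i <;> simp

/-- The weight of the multigraphs containing prescribed edges at prescribed labels. -/
lemma descFactorial_mul_sum_wMG_le (δ : ℕ → ℝ) (hδ : ∀ d, 0 ≤ δ d) (D : ℕ)
    (hD : ∀ d, 0 < δ d → d ≤ D) {n m l : ℕ} (τ : Fin l ↪ Fin m) (T : Fin l → Fin n × Fin n) :
    ((2 * m).descFactorial (2 * l) : ℝ) *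
        (∑ E : Fin m → Fin n × Fin n, if ∀ j, E (τ j) = T j then wMG δ E else 0)
      ≤ (D : ℝ) ^ (2 * l) * MGw n m δ := by
  let w : (Fin m × Fin 2 → Fin n) → ℝ := fun f =>
    ∏ v, δ (Finset.univ.filter fun a => f a = v).card
  have hwE : ∀ E : Fin m → Fin n × Fin n, wMG δ E = w (halfEdgeEquiv n m E) := fun E => by
    simp only [wMG, degMG, w, halfEdgeEquiv, Equiv.coe_fn_mk]
  have key := descFactorial_mul_sum_le w (fun f => Finset.prod_nonneg fun v _ => hδ _)
    (fun π f => Finset.prod_congr rfl fun v _ => congrArg δ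
      (Finset.card_equiv π (by simp)))
    D
    (fun f hf v => hD _ <| lt_of_le_of_ne (hδ _)
      (Finset.prod_ne_zero_iff.1 hf v (Finset.mem_univ v)).symm)
    (τ.prodMap (Function.Embedding.refl (Fin 2))) (halfEdgeEquiv n l T)
  simp only [Fintype.card_prod, Fintype.card_fin, mul_comm _ 2] at key
  rw [MGw, Fintype.sum_equiv (halfEdgeEquiv n m) (fun E => wMG δ E) w hwE]
  refine le_of_eq_of_le (congrArg _ ?_) key
  refine Fintype.sum_equiv (halfEdgeEquiv n m) _ _ fun E => ?_
  rw [hwE]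
  refine if_congr ?_ rfl rfl
  simp only [halfEdgeEquiv, Prod.forall, Fin.forall_fin_two, Prod.ext_iff]
  simp

/-- The image edges of `F` under `σ`, those flagged by `ε` being reversed. -/
def orientedImage {k l n : ℕ} (F : Fin l → Fin k × Fin k) (σ : Fin k ↪ Fin n)
    (ε : Fin l → Bool) (j : Fin l) : Fin n × Fin n :=
  if ε j then (σ (F j).1, σ (F j).2) else (σ (F j).2, σ (F j).1)

lemma exists_eq_orientedImage_of_countSubMG_pos {k l n m : ℕ} (F : Fin l → Fin k × Fin k)
    (E : Fin m → Fin n × Fin n) (hE : 0 < countSubMG F E) :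
    ∃ x : (Fin k ↪ Fin n) × (Fin l ↪ Fin m) × (Fin l → Bool),
      ∀ j, E (x.2.1 j) = orientedImage F x.1 x.2.2 j := by
  obtain ⟨p, -, σ, τ, -, -, h⟩ := Set.nonempty_of_ncard_ne_zero hE.ne'
  refine ⟨⟨σ, τ, fun j => decide (E (τ j) = (σ (F j).1, σ (F j).2))⟩, fun j => ?_⟩
  by_cases hj : E (τ j) = (σ (F j).1, σ (F j).2)
  · simp [orientedImage, hj]
  · have := h j
    rw [Sym2.eq_iff] at this
    rcases this with h1 | h1
    · exact absurd (Prod.ext h1.1 h1.2) hj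
    · simp only [orientedImage, hj, decide_false, Bool.false_eq_true, if_false]
      exact Prod.ext h1.1 h1.2

/-- First moment bound for the appearance of `F`, for bounded degrees. -/
lemma sum_countSubMG_pos_le (δ : ℕ → ℝ) (hδ : ∀ d, 0 ≤ δ d) (D : ℕ)
    (hD : ∀ d, 0 < δ d → d ≤ D) {k l n m : ℕ} (F : Fin l → Fin k × Fin k)
    (hm : 2 * l ≤ m) (hm0 : 0 < m) :
    (∑ E : Fin m → Fin n × Fin n, if 0 < countSubMG F E then wMG δ E else 0)
      ≤ (2 * (D : ℝ) ^ 2) ^ l * ((n : ℝ) ^ k / (m : ℝ) ^ l) * MGw n m δ := by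
  have hw : ∀ E : Fin m → Fin n × Fin n, 0 ≤ wMG δ E :=
    fun E => Finset.prod_nonneg fun v _ => hδ _
  have hMG : 0 ≤ MGw n m δ := Finset.sum_nonneg fun E _ => hw E
  have hmR : (0 : ℝ) < m := by exact_mod_cast hm0
  have hdesc : (m : ℝ) ^ (2 * l) ≤ ((2 * m).descFactorial (2 * l) : ℝ) := by
    have h1 := Nat.pow_sub_le_descFactorial (2 * m) (2 * l)
    have h2 : m ^ (2 * l) ≤ (2 * m + 1 - 2 * l) ^ (2 * l) := Nat.pow_le_pow_left (by omega) _
    exact_mod_cast h2.trans h1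
  have hterm : ∀ x : (Fin k ↪ Fin n) × (Fin l ↪ Fin m) × (Fin l → Bool),
      (∑ E : Fin m → Fin n × Fin n,
        if ∀ j, E (x.2.1 j) = orientedImage F x.1 x.2.2 j then wMG δ E else 0)
      ≤ (D : ℝ) ^ (2 * l) * MGw n m δ / (m : ℝ) ^ (2 * l) := by
    intro x
    rw [le_div_iff₀ (by positivity), mul_comm]
    refine le_trans (mul_le_mul_of_nonneg_right hdesc (Finset.sum_nonneg fun E _ => ?_))
      (descFactorial_mul_sum_wMG_le δ hδ D hD x.2.1 _)
    split_ifs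
    exacts [hw E, le_rfl]
  have hcard : (Fintype.card ((Fin k ↪ Fin n) × (Fin l ↪ Fin m) × (Fin l → Bool)) : ℝ)
      ≤ (n : ℝ) ^ k * ((m : ℝ) ^ l * 2 ^ l) := by
    simp only [Fintype.card_prod, Fintype.card_embedding_eq, Fintype.card_fin, Fintype.card_fun,
      Fintype.card_bool]
    exact_mod_cast Nat.mul_le_mul (Nat.descFactorial_le_pow n k)
      (Nat.mul_le_mul_right _ (Nat.descFactorial_le_pow m l))
  calc (∑ E : Fin m → Fin n × Fin n, if 0 < countSubMG F E then wMG δ E else 0)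
      ≤ ∑ E : Fin m → Fin n × Fin n,
          ∑ x : (Fin k ↪ Fin n) × (Fin l ↪ Fin m) × (Fin l → Bool),
            if ∀ j, E (x.2.1 j) = orientedImage F x.1 x.2.2 j then wMG δ E else 0 := by
        refine Finset.sum_le_sum fun E _ => ?_
        have hnn : ∀ x : (Fin k ↪ Fin n) × (Fin l ↪ Fin m) × (Fin l → Bool),
            0 ≤ if ∀ j, E (x.2.1 j) = orientedImage F x.1 x.2.2 j then wMG δ E else 0 := by
          intro x
          split_ifs
          exacts [hw E, le_rfl]
        split_ifs with hE
        · obtain ⟨x, hx⟩ := exists_eq_orientedImage_of_countSubMG_pos F E hE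
          refine le_of_eq_of_le ?_ (Finset.single_le_sum (fun y _ => hnn y) (Finset.mem_univ x))
          rw [if_pos hx]
        · exact Finset.sum_nonneg fun x _ => hnn x
    _ = ∑ x : (Fin k ↪ Fin n) × (Fin l ↪ Fin m) × (Fin l → Bool),
          ∑ E : Fin m → Fin n × Fin n,
            if ∀ j, E (x.2.1 j) = orientedImage F x.1 x.2.2 j then wMG δ E else 0 :=
        Finset.sum_comm
    _ ≤ ∑ _x : (Fin k ↪ Fin n) × (Fin l ↪ Fin m) × (Fin l → Bool),
          (D : ℝ) ^ (2 * l) * MGw n m δ / (m : ℝ) ^ (2 * l) :=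
        Finset.sum_le_sum fun x _ => hterm x
    _ ≤ (n : ℝ) ^ k * ((m : ℝ) ^ l * 2 ^ l) *
          ((D : ℝ) ^ (2 * l) * MGw n m δ / (m : ℝ) ^ (2 * l)) := by
        rw [Finset.sum_const, Finset.card_univ, nsmul_eq_mul]
        exact mul_le_mul_of_nonneg_right hcard (by positivity)
    _ = (2 * (D : ℝ) ^ 2) ^ l * ((n : ℝ) ^ k / (m : ℝ) ^ l) * MGw n m δ := by
        rw [mul_pow, ← pow_mul]
        have : (m : ℝ) ^ (2 * l) = (m : ℝ) ^ l * (m : ℝ) ^ l := by rw [two_mul, pow_add]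
        rw [this]
        field_simp

/-- for degree weights δ with finite aperiodic support (at least two
elements) and 2m(n)/n → γ strictly between min and max of the support, every
connected multigraph H that is neither a tree nor a unicycle (m(H) ≥ n(H) + 1)
a.a.s. does not appear in a random (n, m(n), δ)-multigraph. -/
theorem stmt15 (δ : ℕ → ℝ) (hδ : ∀ d, 0 ≤ δ d)
    (hfin : {d : ℕ | 0 < δ d}.Finite) (htwo : 1 < Set.ncard {d : ℕ | 0 < δ d})
    (hgcd : ∀ p : ℕ, (∀ d1 d2 : ℕ, 0 < δ d1 → 0 < δ d2 → d2 ≤ d1 → p ∣ d1 - d2) → p = 1)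
    (m : ℕ → ℕ) (γ : ℝ)
    (hγ : Tendsto (fun n : ℕ => 2 * (m n : ℝ) / n) atTop (nhds γ))
    (hmin : ((sInf {d : ℕ | 0 < δ d} : ℕ) : ℝ) < γ)
    (hmax : γ < ((sSup {d : ℕ | 0 < δ d} : ℕ) : ℝ))
    (hMG : ∀ᶠ n in atTop, 0 < MGw n (m n) δ) :
    ∀ (kH lH : ℕ) (H : Fin lH → Fin kH × Fin kH), MGConnected H → kH + 1 ≤ lH →
      Tendsto (fun n : ℕ =>
          (∑ E : Fin (m n) → Fin n × Fin n,
            if 0 < countSubMG H E then wMG δ E else 0) / MGw n (m n) δ)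
        atTop (nhds 0) := by
  intro k l H _ hkl
  have hγ0 : 0 < γ := lt_of_le_of_lt (Nat.cast_nonneg _) hmin
  obtain ⟨D, hD⟩ := hfin.bddAbove
  have hw : ∀ n (E : Fin (m n) → Fin n × Fin n), 0 ≤ wMG δ E :=
    fun n E => Finset.prod_nonneg fun v _ => hδ _
  have hlin : ∀ᶠ n : ℕ in atTop, γ / 4 * n ≤ m n := by
    filter_upwards [hγ.eventually (lt_mem_nhds (half_lt_self hγ0)), eventually_gt_atTop 0]
      with n hn hn0
    have hn0' : (0 : ℝ) < n := by exact_mod_cast hn0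
    rw [lt_div_iff₀ hn0'] at hn
    linarith
  have hlarge : ∀ᶠ n : ℕ in atTop, 2 * (l : ℝ) ≤ γ / 4 * n :=
    (tendsto_natCast_atTop_atTop.const_mul_atTop (by positivity : 0 < γ / 4)).eventually_ge_atTop _
  set C : ℝ := (2 * (D : ℝ) ^ 2) ^ l * (1 / (γ / 4) ^ l) with hC
  have hlim : Tendsto (fun n : ℕ => C * (1 / (n : ℝ))) atTop (nhds 0) := by
    simpa using tendsto_one_div_atTop_nhds_zero_nat.const_mul C
  refine squeeze_zero' (Eventually.of_forall fun n => ?_) ?_ hlim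
  · refine div_nonneg (Finset.sum_nonneg fun E _ => ?_) (Finset.sum_nonneg fun E _ => hw n E)
    split_ifs
    exacts [hw n E, le_rfl]
  · filter_upwards [hMG, hlin, hlarge, eventually_gt_atTop 0] with n hpos hn1 hn2 hn0
    have hn0' : (1 : ℝ) ≤ n := by exact_mod_cast hn0
    have hm2 : 2 * l ≤ m n := by exact_mod_cast hn2.trans hn1
    have hmR : (0 : ℝ) < m n := lt_of_lt_of_le (by positivity) hn1
    rw [div_le_iff₀ hpos]
    refine (sum_countSubMG_pos_le δ hδ D (fun d hd => hD hd) H hm2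
      (by exact_mod_cast hmR)).trans (mul_le_mul_of_nonneg_right ?_ hpos.le)
    rw [hC, mul_assoc]
    refine mul_le_mul_of_nonneg_left ?_ (by positivity)
    rw [div_mul_div_comm, one_mul, div_le_div_iff₀ (by positivity) (by positivity), one_mul]
    calc (n : ℝ) ^ k * ((γ / 4) ^ l * n) = (γ / 4) ^ l * (n : ℝ) ^ (k + 1) := by ring
      _ ≤ (γ / 4) ^ l * (n : ℝ) ^ l :=
          mul_le_mul_of_nonneg_left (pow_le_pow_right₀ hn0' hkl) (by positivity)
      _ = (γ / 4 * n) ^ l := (mul_pow _ _ _).symm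
      _ ≤ (m n : ℝ) ^ l := pow_le_pow_left₀ (by positivity) hn1 l
end
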